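/- arXiv:1301.5297 — 3 statements merged into one kernel-verified Lean document; each statement's English description precedes it below -/
import Mathlib

section
/- A dyadic compact Hausdorff space is metrizable if and only if it is hereditarily supercompact. -/
open Set Topology TopologicalSpace

universe u v

/-- A topological space is *supercompact* if it has a subbase `S` for its topology such that
every cover of the space by members of `S` has a subcover with at most two members. -/
def IsSupercompact (X : Type*) [t : TopologicalSpace X] : Prop :=
  ∃ S : Set (Set X), TopologicalSpace.generateFrom S = t ∧
    ∀ C ⊆ S, ⋃₀ C = univ → ∃ T ⊆ C, T.Finite ∧ T.ncard ≤ 2 ∧ ⋃₀ T = univ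

/-- A topological space is *hereditarily supercompact* if each of its closed subspaces is
supercompact. -/
def IsHereditarilySupercompact (X : Type*) [TopologicalSpace X] : Prop :=
  ∀ Z : Set X, IsClosed Z → IsSupercompact Z

section CompactMetric

/-- A family of sets is *binary* if every finite subfamily whose members meet pairwise (and are
nonempty) has a common point. -/
def IsBinaryFamily {X : Type*} (𝒮 : Set (Set X)) : Prop :=
  ∀ 𝓕 ⊆ 𝒮, 𝓕.Finite → (∀ A ∈ 𝓕, ∀ B ∈ 𝓕, (A ∩ B).Nonempty) → 𝓕.Nonempty → (⋂₀ 𝓕).Nonempty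

/-- Pairwise distinct representatives of finitely many infinite sets. -/
theorem exists_injective_of_forall_infinite {ι X : Type*} [Finite ι] (A : ι → Set X)
    (hA : ∀ i, (A i).Infinite) : ∃ z : ι → X, Function.Injective z ∧ ∀ i, z i ∈ A i := by
  classical
  cases nonempty_fintype ι
  choose t ht hcard using fun i => (hA i).exists_subset_card_eq (Fintype.card ι)
  obtain ⟨z, hz, hzt⟩ := (Finset.all_card_le_biUnion_card_iff_exists_injective t).1 (by
    intro s
    rcases s.eq_empty_or_nonempty with rfl | ⟨i, hi⟩
    · simp
    · calc s.card ≤ Fintype.card ι := s.card_le_univ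
        _ = (t i).card := (hcard i).symm
        _ ≤ _ := Finset.card_le_card (Finset.subset_biUnion_of_mem t hi))
  exact ⟨z, hz, fun i => ht i (hzt i)⟩

/-- `SpecLE 𝒮 x y` says that every member of `𝒮` containing `x` contains `y`. -/
def SpecLE {X : Type*} (𝒮 : Set (Set X)) (x y : X) : Prop :=
  ∀ S ∈ 𝒮, x ∈ S → y ∈ S

theorem SpecLE.refl {X : Type*} (𝒮 : Set (Set X)) (x : X) : SpecLE 𝒮 x x := fun _ _ h => h

theorem SpecLE.trans {X : Type*} {𝒮 : Set (Set X)} {x y z : X} (h : SpecLE 𝒮 x y)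
    (h' : SpecLE 𝒮 y z) : SpecLE 𝒮 x z := fun S hS hx => h' S hS (h S hS hx)

/-- The number of members of `𝒮` containing `x`. -/
noncomputable def specCard {X : Type*} (𝒮 : Set (Set X)) (x : X) : ℕ :=
  {S ∈ 𝒮 | x ∈ S}.ncard

theorem SpecLE.specCard_le {X : Type*} {𝒮 : Set (Set X)} (h𝒮 : 𝒮.Finite) {x y : X}
    (h : SpecLE 𝒮 x y) : specCard 𝒮 x ≤ specCard 𝒮 y :=
  Set.ncard_le_ncard (fun _ hS => ⟨hS.1, h _ hS.1 hS.2⟩) (h𝒮.subset fun _ hS => hS.1)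

theorem SpecLE.symm_of_specCard_le {X : Type*} {𝒮 : Set (Set X)} (h𝒮 : 𝒮.Finite) {x y : X}
    (h : SpecLE 𝒮 x y) (hc : specCard 𝒮 y ≤ specCard 𝒮 x) : SpecLE 𝒮 y x := by
  have := Set.eq_of_subset_of_ncard_le (s := {S ∈ 𝒮 | x ∈ S}) (t := {S ∈ 𝒮 | y ∈ S})
    (fun S hS => ⟨hS.1, h S hS.1 hS.2⟩) hc (h𝒮.subset fun S hS => hS.1)
  intro S hS hy
  have : S ∈ {S ∈ 𝒮 | x ∈ S} := this ▸ ⟨hS, hy⟩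
  exact this.2

variable {X : Type*} [MetricSpace X]

/-- `x` is an accumulation point of the intersection of the members of `𝒮` containing `x`. -/
def SpecAcc (𝒮 : Set (Set X)) (x : X) : Prop :=
  AccPt x (Filter.principal {w | SpecLE 𝒮 x w})

open Classical in
/-- An upper semicontinuous rank, refining `specCard` by accumulation. -/
noncomputable def specRank (𝒮 : Set (Set X)) (x : X) : ℕ :=
  2 * specCard 𝒮 x + if SpecAcc 𝒮 x then 1 else 0

theorem specRank_of_acc {𝒮 : Set (Set X)} {x : X} (h : SpecAcc 𝒮 x) :
    specRank 𝒮 x = 2 * specCard 𝒮 x + 1 := by simp [specRank, h]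

theorem specRank_of_not_acc {𝒮 : Set (Set X)} {x : X} (h : ¬ SpecAcc 𝒮 x) :
    specRank 𝒮 x = 2 * specCard 𝒮 x := by simp [specRank, h]

theorem exists_ball_specRank {𝒮 : Set (Set X)} (h𝒮 : 𝒮.Finite) (hcl : ∀ S ∈ 𝒮, IsClosed S)
    (x : X) : ∃ δ > 0, ∀ w, dist w x < δ → SpecLE 𝒮 w x ∧ specRank 𝒮 w ≤ specRank 𝒮 x ∧
      (specRank 𝒮 w = specRank 𝒮 x → SpecLE 𝒮 x w ∧ (SpecAcc 𝒮 x ∨ w = x)) := by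
  have h1 : ∀ᶠ w in 𝓝 x, SpecLE 𝒮 w x := by
    have : ∀ᶠ w in 𝓝 x, ∀ S ∈ 𝒮, w ∈ S → x ∈ S := by
      rw [Filter.eventually_all_finite h𝒮]
      intro S hS
      by_cases hx : x ∈ S
      · exact Filter.Eventually.of_forall fun _ _ => hx
      · filter_upwards [(hcl S hS).isOpen_compl.mem_nhds hx] with w hw hwS
        exact absurd hwS hw
    exact this
  have h2 : ∀ᶠ w in 𝓝 x, SpecAcc 𝒮 x ∨ (SpecLE 𝒮 x w → w = x) := by
    by_cases hx : SpecAcc 𝒮 x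
    · exact Filter.Eventually.of_forall fun _ => Or.inl hx
    · have := hx
      rw [SpecAcc, accPt_iff_frequently, Filter.not_frequently] at this
      filter_upwards [this] with w hw
      right
      intro hxw
      by_contra hne
      exact hw ⟨hne, hxw⟩
  obtain ⟨δ, hδ, hball⟩ := Metric.eventually_nhds_iff.1 (h1.and h2)
  refine ⟨δ, hδ, fun w hw => ?_⟩
  obtain ⟨hwx, hacc⟩ := hball hw
  have hle := hwx.specCard_le h𝒮
  refine ⟨hwx, ?_⟩
  by_cases hx : SpecAcc 𝒮 x
  · rw [specRank_of_acc hx]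
    by_cases hw' : SpecAcc 𝒮 w
    · rw [specRank_of_acc hw']
      exact ⟨by omega, fun h => ⟨hwx.symm_of_specCard_le h𝒮 (by omega), Or.inl hx⟩⟩
    · rw [specRank_of_not_acc hw']
      exact ⟨by omega, fun h => by omega⟩
  · have hacc := hacc.resolve_left hx
    rcases hle.lt_or_eq with hlt | heq
    · rw [specRank_of_not_acc hx]
      by_cases hw' : SpecAcc 𝒮 w
      · rw [specRank_of_acc hw']
        exact ⟨by omega, fun h => by omega⟩
      · rw [specRank_of_not_acc hw']
        exact ⟨by omega, fun h => by omega⟩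
    · have hxw := hwx.symm_of_specCard_le h𝒮 heq.ge
      have := hacc hxw
      subst this
      exact ⟨le_rfl, fun _ => ⟨hxw, Or.inr rfl⟩⟩

/-- Finitely many closed balls, small with respect to `𝒮`, such that intersecting balls have
comparable centres. -/
structure IsAdaptedTo (𝒮 : Set (Set X)) (P : Set X) (ρ : X → ℝ) : Prop where
  finite : P.Finite
  pos : ∀ x ∈ P, 0 < ρ x
  specLE : ∀ x ∈ P, ∀ w ∈ Metric.closedBall x (ρ x), SpecLE 𝒮 w x
  comparable : ∀ x ∈ P, ∀ y ∈ P,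
    (Metric.closedBall x (ρ x) ∩ Metric.closedBall y (ρ y)).Nonempty →
      SpecLE 𝒮 x y ∨ SpecLE 𝒮 y x
  mem_or_acc : ∀ x ∈ P, ∀ y ∈ P,
    (Metric.closedBall x (ρ x) ∩ Metric.closedBall y (ρ y)).Nonempty → SpecLE 𝒮 x y →
      x ∈ Metric.closedBall y (ρ y) ∨ SpecAcc 𝒮 x

theorem exists_isAdaptedTo_of_le_specRank [CompactSpace X] {𝒮 : Set (Set X)} (h𝒮 : 𝒮.Finite)
    (hcl : ∀ S ∈ 𝒮, IsClosed S) {ε : ℝ} (hε : 0 < ε) {r : ℕ} {P : Set X} {ρ : X → ℝ}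
    (hP : IsAdaptedTo 𝒮 P ρ) (hPε : ∀ x ∈ P, ρ x ≤ ε) (hPr : ∀ x ∈ P, r < specRank 𝒮 x)
    (hcov : ∀ w, r < specRank 𝒮 w → ∃ x ∈ P, w ∈ Metric.ball x (ρ x)) :
    ∃ (P' : Set X) (ρ' : X → ℝ), IsAdaptedTo 𝒮 P' ρ' ∧ (∀ x ∈ P', ρ' x ≤ ε) ∧
      (∀ x ∈ P', r ≤ specRank 𝒮 x) ∧
      ∀ w, r ≤ specRank 𝒮 w → ∃ x ∈ P', w ∈ Metric.ball x (ρ' x) := by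
  classical
  choose δ hδ hδball using exists_ball_specRank h𝒮 hcl
  have hη : ∀ x, ∃ η > 0, η ≤ ε ∧ η < δ x / 2 ∧
      ∀ y ∈ P, (Metric.closedBall x η ∩ Metric.closedBall y (ρ y)).Nonempty →
        x ∈ Metric.closedBall y (ρ y) := by
    intro x
    have : ∀ᶠ w in 𝓝 x, ∀ y ∈ P, w ∈ Metric.closedBall y (ρ y) →
        x ∈ Metric.closedBall y (ρ y) := by
      rw [Filter.eventually_all_finite hP.finite]
      intro y hy
      by_cases hx : x ∈ Metric.closedBall y (ρ y)
      · exact Filter.Eventually.of_forall fun _ _ => hx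
      · filter_upwards [Metric.isClosed_closedBall.isOpen_compl.mem_nhds hx] with w hw hwS
        exact absurd hwS hw
    obtain ⟨γ, hγ, hball⟩ := Metric.eventually_nhds_iff.1 this
    have hδx := hδ x
    refine ⟨min ε (min (δ x / 4) (γ / 2)), by positivity, min_le_left _ _, ?_, ?_⟩
    · calc _ ≤ δ x / 4 := (min_le_right _ _).trans (min_le_left _ _)
        _ < _ := by linarith
    · rintro y hy ⟨w, hwx, hwy⟩
      refine hball ?_ y hy hwy
      calc dist w x ≤ _ := hwx
        _ ≤ γ / 2 := (min_le_right _ _).trans (min_le_right _ _)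
        _ < γ := by linarith
  choose η hη0 hηε hηδ hηP using hη
  set R : Set X := (⋃ x ∈ P, Metric.ball x (ρ x))ᶜ ∩ {w | r ≤ specRank 𝒮 w}
  have hRrank : ∀ x ∈ R, specRank 𝒮 x = r := by
    rintro x ⟨hx, hxr⟩
    have hxr : r ≤ specRank 𝒮 x := hxr
    by_contra hne
    obtain ⟨y, hy, hxy⟩ := hcov x (lt_of_le_of_ne hxr (Ne.symm hne))
    exact hx (Set.mem_biUnion hy hxy)
  have hRclosed : IsClosed R := by
    refine (isOpen_biUnion fun _ _ => Metric.isOpen_ball).isClosed_compl.inter ?_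
    rw [← isOpen_compl_iff, Metric.isOpen_iff]
    intro x hx
    refine ⟨δ x, hδ x, fun w hw => ?_⟩
    have hx : ¬ r ≤ specRank 𝒮 x := hx
    have := (hδball x w hw).2.1
    show ¬ r ≤ specRank 𝒮 w
    omega
  obtain ⟨P₁, hP₁R, hP₁fin, hP₁cov⟩ := hRclosed.isCompact.elim_finite_subcover_image
    (b := R) (c := fun x => Metric.ball x (η x)) (fun x _ => Metric.isOpen_ball)
    (fun x hx => Set.mem_biUnion hx (Metric.mem_ball_self (hη0 x)))
  have hdisj : ∀ x ∈ P₁, x ∉ P := fun x hx hxP =>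
    (hP₁R hx).1 (Set.mem_biUnion hxP (Metric.mem_ball_self (hP.pos x hxP)))
  set ρ' : X → ℝ := fun x => if x ∈ P then ρ x else η x
  have hρP : ∀ x ∈ P, ρ' x = ρ x := fun x hx => if_pos hx
  have hρP₁ : ∀ x ∈ P₁, ρ' x = η x := fun x hx => if_neg (hdisj x hx)
  have hsmall : ∀ x ∈ P₁, ∀ w ∈ Metric.closedBall x (η x), SpecLE 𝒮 w x := by
    intro x _ w hw
    refine (hδball x w (lt_of_le_of_lt hw ?_)).1
    have := hηδ x
    have := hδ x
    linarith
  have hnear : ∀ x ∈ P₁, ∀ y ∈ P₁,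
      (Metric.closedBall x (η x) ∩ Metric.closedBall y (η y)).Nonempty →
        SpecLE 𝒮 x y ∧ SpecLE 𝒮 y x ∧ (x = y ∨ SpecAcc 𝒮 x) := by
    rintro x hx y hy ⟨w, hwx, hwy⟩
    have hwx : dist w x ≤ η x := hwx
    have hwy : dist w y ≤ η y := hwy
    have hd : dist x y ≤ η x + η y := by
      calc dist x y ≤ dist w x + dist w y := dist_triangle_left _ _ _
        _ ≤ _ := add_le_add hwx hwy
    have hrx := hRrank x (hP₁R hx)
    have hry := hRrank y (hP₁R hy)
    have h1 := hηδ x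
    have h2 := hηδ y
    rcases le_total (δ x) (δ y) with h | h
    · obtain ⟨h3, -, h4⟩ := hδball y x (by linarith)
      obtain ⟨h5, h6⟩ := h4 (hrx.trans hry.symm)
      refine ⟨h3, h5, ?_⟩
      rcases h6 with h6 | h6
      · right
        by_contra hx'
        rw [specRank_of_not_acc hx'] at hrx
        rw [specRank_of_acc h6] at hry
        omega
      · exact Or.inl h6
    · obtain ⟨h3, -, h4⟩ := hδball x y (by rw [dist_comm]; linarith)
      obtain ⟨h5, h6⟩ := h4 (hry.trans hrx.symm)
      refine ⟨h5, h3, ?_⟩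
      rcases h6 with h6 | h6
      · exact Or.inr h6
      · exact Or.inl h6.symm
  refine ⟨P ∪ P₁, ρ', ⟨hP.finite.union hP₁fin, ?_, ?_, ?_, ?_⟩, ?_, ?_, ?_⟩
  · rintro x (hx | hx)
    · rw [hρP x hx]; exact hP.pos x hx
    · rw [hρP₁ x hx]; exact hη0 x
  · rintro x (hx | hx)
    · rw [hρP x hx]; exact hP.specLE x hx
    · rw [hρP₁ x hx]; exact hsmall x hx
  · rintro x (hx | hx) y (hy | hy) hxy
    · rw [hρP x hx, hρP y hy] at hxy; exact hP.comparable x hx y hy hxy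
    · rw [hρP x hx, hρP₁ y hy, Set.inter_comm] at hxy
      exact Or.inr (hP.specLE x hx y (hηP y x hx hxy))
    · rw [hρP₁ x hx, hρP y hy] at hxy
      exact Or.inl (hP.specLE y hy x (hηP x y hy hxy))
    · rw [hρP₁ x hx, hρP₁ y hy] at hxy
      exact Or.inl (hnear x hx y hy hxy).1
  · rintro x (hx | hx) y (hy | hy) hxy hle
    · rw [hρP x hx, hρP y hy] at hxy
      rw [hρP y hy]
      exact hP.mem_or_acc x hx y hy hxy hle
    · right
      by_contra hacc
      have h1 := hPr x hx
      rw [specRank_of_not_acc hacc] at h1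
      have h2 := hRrank y (hP₁R hy)
      have h3 := hle.specCard_le h𝒮
      have h4 : 2 * specCard 𝒮 y ≤ specRank 𝒮 y := Nat.le_add_right _ _
      omega
    · rw [hρP₁ x hx, hρP y hy] at hxy
      rw [hρP y hy]
      exact Or.inl (hηP x y hy hxy)
    · rw [hρP₁ x hx, hρP₁ y hy] at hxy
      rcases (hnear x hx y hy hxy).2.2 with rfl | h
      · left
        rw [hρP₁ x hx]
        exact Metric.mem_closedBall_self (hη0 x).le
      · exact Or.inr h
  · rintro x (hx | hx)
    · rw [hρP x hx]; exact hPε x hx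
    · rw [hρP₁ x hx]; exact hηε x
  · rintro x (hx | hx)
    · exact (hPr x hx).le
    · exact (hRrank x (hP₁R hx)).ge
  · intro w hw
    by_cases hwP : ∃ x ∈ P, w ∈ Metric.ball x (ρ x)
    · obtain ⟨x, hx, hwx⟩ := hwP
      exact ⟨x, Or.inl hx, by rwa [hρP x hx]⟩
    · have hwR : w ∈ R := by
        refine ⟨fun h => hwP ?_, hw⟩
        simpa using h
      obtain ⟨x, hx, hwx⟩ := Set.mem_iUnion₂.1 (hP₁cov hwR)
      exact ⟨x, Or.inr hx, by rwa [hρP₁ x hx]⟩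

theorem exists_isAdaptedTo_cover [CompactSpace X] {𝒮 : Set (Set X)} (h𝒮 : 𝒮.Finite)
    (hcl : ∀ S ∈ 𝒮, IsClosed S) {ε : ℝ} (hε : 0 < ε) :
    ∃ (P : Set X) (ρ : X → ℝ), IsAdaptedTo 𝒮 P ρ ∧ (∀ x ∈ P, ρ x ≤ ε) ∧
      ∀ w, ∃ x ∈ P, w ∈ Metric.ball x (ρ x) := by
  have key : ∀ r ≤ 2 * 𝒮.ncard + 2, ∃ (P : Set X) (ρ : X → ℝ), IsAdaptedTo 𝒮 P ρ ∧
      (∀ x ∈ P, ρ x ≤ ε) ∧ (∀ x ∈ P, r ≤ specRank 𝒮 x) ∧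
      ∀ w, r ≤ specRank 𝒮 w → ∃ x ∈ P, w ∈ Metric.ball x (ρ x) := by
    intro r hr
    induction hr using Nat.decreasingInduction with
    | self =>
      refine ⟨∅, fun _ => 1, ⟨Set.finite_empty, by simp, by simp, by simp, by simp⟩, by simp,
        by simp, fun w hw => ?_⟩
      have h1 : specCard 𝒮 w ≤ 𝒮.ncard := Set.ncard_le_ncard (fun S hS => hS.1) h𝒮
      have h2 : specRank 𝒮 w ≤ 2 * specCard 𝒮 w + 1 := by
        unfold specRank; split_ifs <;> omega
      omega
    | of_succ r hr ih =>
      obtain ⟨P, ρ, hP, hPε, hPr, hcov⟩ := ih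
      exact exists_isAdaptedTo_of_le_specRank h𝒮 hcl hε hP hPε hPr hcov
  obtain ⟨P, ρ, hP, hPε, -, hcov⟩ := key 0 (Nat.zero_le _)
  exact ⟨P, ρ, hP, hPε, fun w => hcov w (Nat.zero_le _)⟩

theorem exists_clique_minimum {𝒮 : Set (Set X)} (h𝒮 : 𝒮.Finite) {P : Set X} {ρ : X → ℝ}
    (hP : IsAdaptedTo 𝒮 P ρ) {Q : Set X} (hQP : Q ⊆ P) (hQ : Q.Nonempty)
    (hlink : ∀ x ∈ Q, ∀ y ∈ Q,
      (Metric.closedBall x (ρ x) ∩ Metric.closedBall y (ρ y)).Nonempty) :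
    ∃ x ∈ Q, ∀ y ∈ Q, SpecLE 𝒮 x y := by
  obtain ⟨x, hx, hmin⟩ := Set.exists_min_image Q (specCard 𝒮) (hP.finite.subset hQP) hQ
  refine ⟨x, hx, fun y hy => ?_⟩
  rcases hP.comparable x (hQP hx) y (hQP hy) (hlink x hx y hy) with h | h
  · exact h
  · exact h.symm_of_specCard_le h𝒮 (hmin y hy)

/-- A finite binary family of closed sets in a compact metric space can be enlarged by a finite
cover by small closed sets to a binary family. -/
theorem IsBinaryFamily.exists_union_cover [CompactSpace X] {𝒮 : Set (Set X)} (h𝒮 : 𝒮.Finite)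
    (hcl : ∀ S ∈ 𝒮, IsClosed S) (hbin : IsBinaryFamily 𝒮) {ε : ℝ} (hε : 0 < ε) :
    ∃ 𝒯 : Set (Set X), 𝒯.Finite ∧ (∀ T ∈ 𝒯, IsClosed T) ∧ (∀ w, ∃ T ∈ 𝒯, w ∈ T) ∧
      (∀ T ∈ 𝒯, ∃ x, T ⊆ Metric.closedBall x (3 * ε)) ∧ IsBinaryFamily (𝒮 ∪ 𝒯) := by
  obtain ⟨P, ρ, hP, hPε, hcov⟩ := exists_isAdaptedTo_cover h𝒮 hcl hε
  let T : X → Set X := fun x => Metric.closedBall x (ρ x)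
  have hTspec : ∀ x ∈ P, ∀ w ∈ T x, SpecLE 𝒮 w x := hP.specLE
  let 𝒬 := {Q : Set X // Q ⊆ P ∧ Q.Nonempty ∧ ∀ x ∈ Q, ∀ y ∈ Q, (T x ∩ T y).Nonempty}
  have : Finite 𝒬 := (hP.finite.finite_subsets.subset fun Q hQ => hQ.1 :
    {Q : Set X | Q ⊆ P ∧ Q.Nonempty ∧ ∀ x ∈ Q, ∀ y ∈ Q, (T x ∩ T y).Nonempty}.Finite).to_subtype
  choose c hcQ hcle using fun Q : 𝒬 =>
    exists_clique_minimum h𝒮 hP Q.2.1 Q.2.2.1 Q.2.2.2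
  let B := {Q : 𝒬 // SpecAcc 𝒮 (c Q)}
  have hcP : ∀ Q : 𝒬, c Q ∈ P := fun Q => Q.2.1 (hcQ Q)
  obtain ⟨z, hzinj, hz⟩ := exists_injective_of_forall_infinite
    (fun Q : B => (Metric.ball (c Q.1) (ρ (c Q.1)) ∩ {w | SpecLE 𝒮 (c Q.1) w}) \ P)
    (fun Q => (Set.Infinite.of_accPt
      (AccPt.nhds_inter Q.2 (Metric.ball_mem_nhds _ (hP.pos _ (hcP Q.1))))).sdiff hP.finite)
  have hzball : ∀ Q : B, z Q ∈ Metric.ball (c Q.1) (ρ (c Q.1)) := fun Q => (hz Q).1.1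
  have hzle : ∀ Q : B, SpecLE 𝒮 (c Q.1) (z Q) := fun Q => (hz Q).1.2
  have hzP : ∀ Q : B, z Q ∉ P := fun Q => (hz Q).2
  obtain ⟨τ, hτ0, hτball, hτz, hτP⟩ : ∃ τ > 0, (∀ Q : B, Metric.ball (z Q) τ ⊆ T (c Q.1)) ∧
      (∀ Q Q' : B, Q ≠ Q' → 2 * τ ≤ dist (z Q) (z Q')) ∧
      ∀ p ∈ P, ∀ Q : B, τ ≤ dist p (z Q) := by
    have hlt : ∀ r > 0, ∀ᶠ τ in 𝓝[>] (0 : ℝ), τ ≤ r := fun r hr => by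
      filter_upwards [Ioc_mem_nhdsGT hr] with τ h using h.2
    have h1 : ∀ᶠ τ in 𝓝[>] (0 : ℝ), ∀ Q : B, Metric.ball (z Q) τ ⊆ T (c Q.1) := by
      refine Filter.eventually_all.2 fun Q => ?_
      have hd : dist (z Q) (c Q.1) < ρ (c Q.1) := hzball Q
      filter_upwards [hlt _ (sub_pos.2 hd)] with τ hτ w hw
      have hw : dist w (z Q) < τ := hw
      have := dist_triangle w (z Q) (c Q.1)
      show dist w (c Q.1) ≤ ρ (c Q.1)
      linarith
    have h2 : ∀ᶠ τ in 𝓝[>] (0 : ℝ), ∀ Q Q' : B, Q ≠ Q' → 2 * τ ≤ dist (z Q) (z Q') := by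
      refine Filter.eventually_all.2 fun Q => Filter.eventually_all.2 fun Q' => ?_
      by_cases h : Q = Q'
      · exact Filter.Eventually.of_forall fun _ h' => absurd h h'
      · have : 0 < dist (z Q) (z Q') / 2 := half_pos (dist_pos.2 fun he => h (hzinj he))
        filter_upwards [hlt _ this] with τ hτ _
        linarith
    have h3 : ∀ᶠ τ in 𝓝[>] (0 : ℝ), ∀ p ∈ P, ∀ Q : B, τ ≤ dist p (z Q) := by
      refine (Filter.eventually_all_finite hP.finite).2 fun p hp =>
        Filter.eventually_all.2 fun Q => hlt _ (dist_pos.2 ?_)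
      rintro rfl
      exact hzP Q hp
    obtain ⟨τ, h, h1, h2, h3⟩ :=
      ((eventually_mem_nhdsWithin (a := (0 : ℝ))).and (h1.and (h2.and h3))).exists
    exact ⟨τ, h, h1, h2, h3⟩
  let T' : X → Set X := fun x =>
    (T x ∩ {w | ∀ Q : B, x ≠ c Q.1 → τ ≤ dist w (z Q)}) ∪ z '' {Q : B | x ∈ Q.1.1}
  have hT'spec : ∀ x ∈ P, ∀ w ∈ T' x, SpecLE 𝒮 w x := by
    rintro x hx w (hw | ⟨Q, hQ, rfl⟩)
    · exact hTspec x hx w hw.1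
    · exact (hTspec _ (hcP Q.1) _ (Metric.ball_subset_closedBall (hzball Q))).trans
        (hcle Q.1 x hQ)
  have hlink : ∀ x y, (T' x ∩ T' y).Nonempty → (T x ∩ T y).Nonempty := by
    have aux : ∀ x y, ∀ Q : B, x ∈ Q.1.1 →
        z Q ∈ T y ∩ {w | ∀ Q : B, y ≠ c Q.1 → τ ≤ dist w (z Q)} → (T x ∩ T y).Nonempty := by
      intro x y Q hx hy
      have hyc : y = c Q.1 := by
        by_contra hne
        have := hy.2 Q hne
        rw [dist_self] at this
        exact hτ0.not_ge this
      exact Q.1.2.2.2 x hx y (hyc ▸ hcQ Q.1)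
    rintro x y ⟨w, hwx | ⟨Q, hQ, rfl⟩, hwy | ⟨Q', hQ', h⟩⟩
    · exact ⟨w, hwx.1, hwy.1⟩
    · rw [Set.inter_comm]
      exact aux y x Q' hQ' (h ▸ hwx)
    · exact aux x y Q hQ hwy
    · obtain rfl := hzinj h
      exact Q'.1.2.2.2 x hQ y hQ'
  have hcommon : ∀ Q : 𝒬, ∃ v, SpecLE 𝒮 (c Q) v ∧ ∀ y ∈ Q.1, v ∈ T' y := by
    intro Q
    by_cases hQ : SpecAcc 𝒮 (c Q)
    · exact ⟨z ⟨Q, hQ⟩, hzle ⟨Q, hQ⟩, fun y hy => Or.inr ⟨⟨Q, hQ⟩, hy, rfl⟩⟩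
    · refine ⟨c Q, SpecLE.refl _ _, fun y hy => Or.inl ⟨?_, fun Q' _ => hτP _ (hcP Q) Q'⟩⟩
      exact (hP.mem_or_acc _ (hcP Q) y (Q.2.1 hy) (Q.2.2.2 _ (hcQ Q) y hy)
        (hcle Q y hy)).resolve_right hQ
  refine ⟨Set.image T' P, hP.finite.image _, ?_, ?_, ?_, ?_⟩
  · rintro _ ⟨x, -, rfl⟩
    refine (Metric.isClosed_closedBall.inter ?_).union (Set.toFinite _).isClosed
    simp only [Set.ofPred_forall]
    exact isClosed_iInter fun Q => isClosed_iInter fun _ =>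
      isClosed_le continuous_const (by fun_prop)
  · intro w
    obtain ⟨x, hx, hwx⟩ := hcov w
    by_cases h : ∀ Q : B, x ≠ c Q.1 → τ ≤ dist w (z Q)
    · exact ⟨_, Set.mem_image_of_mem _ hx, Or.inl ⟨Metric.ball_subset_closedBall hwx, h⟩⟩
    · push Not at h
      obtain ⟨Q, -, hQ⟩ := h
      refine ⟨_, Set.mem_image_of_mem _ (hcP Q.1), Or.inl ⟨hτball Q hQ, fun Q' hQ' => ?_⟩⟩
      have h1 := hτz Q Q' (by rintro rfl; exact hQ' rfl)
      have h2 := dist_triangle_left (z Q) (z Q') w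
      linarith
  · rintro _ ⟨x, hx, rfl⟩
    refine ⟨x, ?_⟩
    rintro w (hw | ⟨Q, hQ, rfl⟩)
    · have hw : dist w x ≤ ρ x := hw.1
      show dist w x ≤ 3 * ε
      linarith [hPε x hx]
    · obtain ⟨v, hv, hv'⟩ := Q.1.2.2.2 _ (hcQ Q.1) x hQ
      have h1 : dist v (c Q.1) ≤ ρ (c Q.1) := hv
      have h2 : dist v x ≤ ρ x := hv'
      have h3 : dist (z Q) (c Q.1) < ρ (c Q.1) := hzball Q
      have h4 := dist_triangle4 (z Q) (c Q.1) v x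
      rw [dist_comm (c Q.1) v] at h4
      show dist (z Q) x ≤ 3 * ε
      linarith [hPε x hx, hPε _ (hcP Q.1)]
  · intro 𝓕 h𝓕 hfin hmeet hne
    by_cases hQ : {x ∈ P | T' x ∈ 𝓕}.Nonempty
    · let Q : 𝒬 := ⟨{x ∈ P | T' x ∈ 𝓕}, fun x hx => hx.1, hQ, fun x hx y hy =>
        hlink x y (hmeet _ hx.2 _ hy.2)⟩
      obtain ⟨v, hv, hvT⟩ := hcommon Q
      have hcQ' : T' (c Q) ∈ 𝓕 := (hcQ Q).2
      refine ⟨v, fun A hA => ?_⟩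
      by_cases hAS : A ∈ 𝒮
      · obtain ⟨w, hwA, hwc⟩ := hmeet A hA _ hcQ'
        exact hv A hAS (hT'spec _ (hcP Q) w hwc A hAS hwA)
      · obtain ⟨x, hx, rfl⟩ := (h𝓕 hA).resolve_left hAS
        exact hvT x ⟨hx, hA⟩
    · refine hbin 𝓕 (fun A hA => (h𝓕 hA).resolve_right ?_) hfin hmeet hne
      rintro ⟨x, hx, rfl⟩
      exact hQ ⟨x, hx, hA⟩

theorem isSupercompact_of_metricSpace (X : Type*) [MetricSpace X] [CompactSpace X] :
    IsSupercompact X := by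
  let Good : Set (Set X) → Prop := fun 𝒮 =>
    𝒮.Finite ∧ (∀ S ∈ 𝒮, IsClosed S) ∧ IsBinaryFamily 𝒮
  have step : ∀ (n : ℕ) (𝒮 : {𝒮 // Good 𝒮}), ∃ 𝒮' : {𝒮 // Good 𝒮}, 𝒮.1 ⊆ 𝒮'.1 ∧
      ∃ 𝒯 ⊆ 𝒮'.1, 𝒯.Finite ∧ (∀ w, ∃ T ∈ 𝒯, w ∈ T) ∧
        ∀ T ∈ 𝒯, ∃ x, T ⊆ Metric.closedBall x (3 * (1 / (n + 1 : ℝ))) := by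
    rintro n ⟨𝒮, hfin, hcl, hbin⟩
    obtain ⟨𝒯, h𝒯, h𝒯cl, hcov, hsmall, hb⟩ :=
      hbin.exists_union_cover hfin hcl (ε := 1 / (n + 1 : ℝ)) Nat.one_div_pos_of_nat
    exact ⟨⟨𝒮 ∪ 𝒯, hfin.union h𝒯, fun S hS => hS.elim (hcl S) (h𝒯cl S), hb⟩,
      Set.subset_union_left, 𝒯, Set.subset_union_right, h𝒯, hcov, hsmall⟩
  choose next hnext hmesh using step
  let seq : ℕ → {𝒮 // Good 𝒮} := fun n => Nat.rec
    ⟨∅, Set.finite_empty, by simp, fun 𝓕 h𝓕 _ _ hne =>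
      absurd (Set.subset_empty_iff.1 h𝓕) hne.ne_empty⟩ next n
  have hmono : Monotone fun n => (seq n).1 := monotone_nat_of_le_succ fun n => hnext n (seq n)
  refine ⟨{U | ∃ n, Uᶜ ∈ (seq n).1}, le_antisymm ?_ ?_, ?_⟩
  · intro U hU
    refine (@isOpen_iff_forall_mem_open X (generateFrom _) U).2 fun x hx => ?_
    obtain ⟨δ, hδ, hball⟩ := Metric.isOpen_iff.1 hU x hx
    obtain ⟨n, hn⟩ := exists_nat_one_div_lt (show 0 < δ / 6 by positivity)
    obtain ⟨𝒯, h𝒯, hfin, hcov, hsmall⟩ := hmesh n (seq n)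
    refine ⟨⋂ A ∈ {A ∈ 𝒯 | x ∉ A}, Aᶜ, fun w hw => ?_, ?_, ?_⟩
    · obtain ⟨A, hA, hwA⟩ := hcov w
      have hxA : x ∈ A := by
        by_contra hxA
        exact Set.mem_iInter₂.1 hw A ⟨hA, hxA⟩ hwA
      obtain ⟨y, hy⟩ := hsmall A hA
      have h1 : dist w y ≤ _ := hy hwA
      have h2 : dist x y ≤ _ := hy hxA
      refine hball (show dist w x < δ from ?_)
      linarith [dist_triangle_right w x y]
    · refine @Set.Finite.isOpen_biInter _ _ (generateFrom _) _ _ (hfin.subset fun A hA => hA.1)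
        fun A hA => isOpen_generateFrom_of_mem ⟨n + 1, ?_⟩
      rw [compl_compl]
      exact h𝒯 hA.1
    · exact Set.mem_iInter₂.2 fun A hA => hA.2
  · refine le_generateFrom ?_
    rintro U ⟨n, hn⟩
    exact isClosed_compl_iff.1 ((seq n).2.2.1 _ hn)
  · intro C hC hcov
    obtain ⟨C', hC'C, hC'fin, hC'cov⟩ := isCompact_univ.elim_finite_subcover_image
      (b := C) (c := id) (fun U hU => by
        obtain ⟨n, hn⟩ := hC hU
        exact isClosed_compl_iff.1 ((seq n).2.2.1 _ hn))
      (by rw [← hcov, Set.sUnion_eq_biUnion]; rfl)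
    by_contra! hno
    have hpair : ∀ U ∈ C', ∀ V ∈ C', (Uᶜ ∩ Vᶜ).Nonempty := by
      intro U hU V hV
      rw [Set.nonempty_iff_ne_empty]
      intro hempty
      refine hno {U, V} (Set.insert_subset (hC'C hU) (Set.singleton_subset_iff.2 (hC'C hV)))
        (Set.toFinite _)
        ((Set.ncard_insert_le U {V}).trans (by rw [Set.ncard_singleton])) ?_
      rw [Set.sUnion_pair, ← compl_compl (U ∪ V), Set.compl_union, hempty, Set.compl_empty]
    have hne : C'.Nonempty := by
      rw [Set.nonempty_iff_ne_empty]
      rintro rfl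
      refine hno ∅ (Set.empty_subset _) Set.finite_empty (by simp) ?_
      simpa [Set.univ_subset_iff, eq_comm] using hC'cov
    choose! N hN using fun U (hU : U ∈ C') => hC (hC'C hU)
    obtain ⟨M, hM⟩ := (hC'fin.image N).bddAbove
    obtain ⟨v, hv⟩ := (seq M).2.2.2 (compl '' C')
      (by
        rintro _ ⟨U, hU, rfl⟩
        exact hmono (hM (Set.mem_image_of_mem N hU)) (hN U hU))
      (hC'fin.image _)
      (by
        rintro _ ⟨U, hU, rfl⟩ _ ⟨V, hV, rfl⟩
        exact hpair U hU V hV)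
      (hne.image _)
    obtain ⟨U, hU, hvU⟩ := Set.mem_iUnion₂.1 (hC'cov (Set.mem_univ v))
    exact hv _ (Set.mem_image_of_mem _ hU) hvU

end CompactMetric

theorem isHereditarilySupercompact_of_metrizableSpace (X : Type*) [TopologicalSpace X]
    [CompactSpace X] [MetrizableSpace X] : IsHereditarilySupercompact X := by
  intro Z hZ
  have : CompactSpace Z := isCompact_iff_compactSpace.1 hZ.isCompact
  let _ := metrizableSpaceMetric Z
  exact isSupercompact_of_metricSpace Z

theorem exists_countable_closed_under {α : Type*} (g : List α → Set α)
    (hg : ∀ l, (g l).Countable) :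
    ∃ J : Set α, J.Countable ∧ ∀ l : List α, (∀ i ∈ l, i ∈ J) → g l ⊆ J := by
  classical
  let next : Set α → Set α := fun J => J ∪ ⋃ l : List J, g (l.map (↑))
  let J : ℕ → Set α := fun n => next^[n] ∅
  have hsucc : ∀ n, J (n + 1) = next (J n) := fun n => Function.iterate_succ_apply' next n ∅
  have hmono : Monotone J := monotone_nat_of_le_succ fun n => by
    rw [hsucc]
    exact Set.subset_union_left
  refine ⟨⋃ n, J n, Set.countable_iUnion fun n => ?_, fun l hl => ?_⟩
  · induction n with
    | zero => exact Set.countable_empty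
    | succ n ih =>
      rw [hsucc]
      have := ih.to_subtype
      exact ih.union (Set.countable_iUnion fun l => hg _)
  · obtain ⟨n, hn⟩ := hmono.directed_le.exists_mem_subset_of_finset_subset_biUnion
      (s := l.toFinset) (fun i hi => hl i (by simpa using hi))
    have hn' : ∀ i ∈ l, i ∈ J n := fun i hi => hn (by simpa using hi)
    lift l to List (J n) using hn'
    refine subset_trans ?_ (Set.subset_iUnion J (n + 1))
    rw [hsucc]
    exact (Set.subset_iUnion (fun l : List (J n) => g (l.map (↑))) l).trans
      Set.subset_union_right

theorem secondCountableTopology_of_surjective {K X : Type*} [TopologicalSpace K] [CompactSpace K]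
    [SecondCountableTopology K] [TopologicalSpace X] [T2Space X] {g : K → X} (hg : Continuous g)
    (hsurj : Function.Surjective g) : SecondCountableTopology X := by
  let W : Set (Set (Set K)) := {w | w.Finite ∧ w ⊆ countableBasis K}
  have hW : W.Countable := Set.countable_ofPred_finite_subset (countable_countableBasis K)
  refine (isTopologicalBasis_of_isOpen_of_nhds
    (s := (fun w : Set (Set K) => (g '' (⋃₀ w)ᶜ)ᶜ) '' W) ?_ ?_).secondCountableTopology
      (hW.image _)
  · rintro _ ⟨w, hw, rfl⟩
    refine (IsClosed.isCompact ?_ |>.image hg).isClosed.isOpen_compl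
    exact (isOpen_sUnion fun s hs => isOpen_of_mem_countableBasis (hw.2 hs)).isClosed_compl
  · intro x U hx hU
    obtain ⟨w, hwb, hwfin, hw⟩ : ∃ w ⊆ countableBasis K, w.Finite ∧
        g ⁻¹' {x} ⊆ ⋃₀ w ∧ ⋃₀ w ⊆ g ⁻¹' U := by
      have hcomp : IsCompact (g ⁻¹' {x}) := (isClosed_singleton.preimage hg).isCompact
      obtain ⟨w, hw, hwfin, hcov⟩ := hcomp.elim_finite_subcover_image
        (b := {s ∈ countableBasis K | s ⊆ g ⁻¹' U}) (c := id)
        (fun s hs => isOpen_of_mem_countableBasis hs.1) (fun y hy => by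
          have hyU : y ∈ g ⁻¹' U := by
            rw [Set.mem_preimage, show g y = x from hy]
            exact hx
          obtain ⟨s, hs, hys, hsU⟩ :=
            (isBasis_countableBasis K).exists_subset_of_mem_open hyU (hU.preimage hg)
          exact Set.mem_biUnion (show s ∈ {s ∈ countableBasis K | s ⊆ g ⁻¹' U} from ⟨hs, hsU⟩)
            hys)
      rw [show ⋃ i ∈ w, id i = ⋃₀ w from Set.sUnion_eq_biUnion.symm] at hcov
      exact ⟨w, fun s hs => (hw hs).1, hwfin, hcov, Set.sUnion_subset fun s hs => (hw hs).2⟩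
    refine ⟨_, Set.mem_image_of_mem _ ⟨hwfin, hwb⟩, ?_, ?_⟩
    · rintro ⟨y, hy, rfl⟩
      exact hy (hw.1 rfl)
    · intro y hy
      obtain ⟨k, rfl⟩ := hsurj y
      by_contra hk
      exact hy ⟨k, fun hk' => hk (hw.2 hk'), rfl⟩

section Dyadic

variable {ι X : Type*}

/-- The basic clopen sets of `ι → Bool` given by the values of `p` and of `q` on `K` have disjoint
images under `f`. -/
def SeparatedOn (f : (ι → Bool) → X) (K : Finset ι) (p q : ι → Bool) : Prop :=
  ∀ x y, (∀ i ∈ K, x i = p i) → (∀ i ∈ K, y i = q i) → f x ≠ f y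

theorem exists_separatedOn [TopologicalSpace X] [T2Space X] {f : (ι → Bool) → X}
    (hf : Continuous f) {p q : ι → Bool} (hpq : f p ≠ f q) : ∃ K, SeparatedOn f K p q := by
  classical
  obtain ⟨U, V, hU, hV, hpU, hqV, hUV⟩ := t2_separation hpq
  obtain ⟨I, u, hu, hIU⟩ := isOpen_pi_iff.1 (hU.preimage hf) p hpU
  obtain ⟨L, v, hv, hLV⟩ := isOpen_pi_iff.1 (hV.preimage hf) q hqV
  refine ⟨I ∪ L, fun x y hx hy hxy => ?_⟩
  have h1 : f x ∈ U := hIU fun i hi => by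
    rw [hx i (Finset.mem_union_left _ hi)]
    exact (hu i hi).2
  have h2 : f y ∈ V := hLV fun i hi => by
    rw [hy i (Finset.mem_union_right _ hi)]
    exact (hv i hi).2
  exact Set.disjoint_left.1 hUV h1 (hxy ▸ h2)

variable [TopologicalSpace X] {f : (ι → Bool) → X}

theorem exists_ne_of_not_metrizableSpace [CompactSpace X] [T2Space X]
    (hf : Continuous f) (hsurj : Function.Surjective f) (hX : ¬ MetrizableSpace X)
    {J : Set ι} (hJ : J.Countable) :
    ∃ p q : ι → Bool, (∀ i ∈ J, p i = q i) ∧ f p ≠ f q := by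
  classical
  by_contra! h
  have := hJ.to_subtype
  let ext : (J → Bool) → ι → Bool := fun y i => if hi : i ∈ J then y ⟨i, hi⟩ else false
  have hext : Continuous ext := by
    refine continuous_pi fun i => ?_
    by_cases hi : i ∈ J
    · simpa only [ext, dif_pos hi] using continuous_apply _
    · simpa only [ext, dif_neg hi] using continuous_const
  have := secondCountableTopology_of_surjective (hf.comp hext) fun x => by
    obtain ⟨p, rfl⟩ := hsurj x
    exact ⟨fun i => p i, h _ _ fun i hi => by simp [ext, hi]⟩
  exact hX (metrizableSpace_of_t3_secondCountable X)

theorem exists_uncountable_pairwiseDisjoint [DecidableEq ι] [CompactSpace X] [T2Space X]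
    (hf : Continuous f) (hsurj : Function.Surjective f) (hX : ¬ MetrizableSpace X) :
    ∃ (R A : Finset ι) (𝓕 : Set (Finset ι × (ι → Bool) × (ι → Bool))), ¬ 𝓕.Countable ∧
      (∀ t ∈ 𝓕, SeparatedOn f t.1 t.2.1 t.2.2 ∧
        ∀ i ∈ R, t.2.1 i = decide (i ∈ A) ∧ t.2.2 i = decide (i ∈ A)) ∧
      𝓕.PairwiseDisjoint fun t => t.1 \ R := by
  by_contra! hcount
  let Good : Finset ι → Finset ι → Finset ι × (ι → Bool) × (ι → Bool) → Prop := fun R A t =>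
    SeparatedOn f t.1 t.2.1 t.2.2 ∧
      ∀ i ∈ R, t.2.1 i = decide (i ∈ A) ∧ t.2.2 i = decide (i ∈ A)
  have hmax : ∀ R A, ∃ 𝓕 : Set (Finset ι × (ι → Bool) × (ι → Bool)),
      Maximal (fun 𝓕 => (∀ t ∈ 𝓕, Good R A t) ∧ 𝓕.PairwiseDisjoint fun t => t.1 \ R) 𝓕 := by
    intro R A
    refine zorn_subset _ fun c hc hchain => ⟨⋃₀ c, ⟨?_, ?_⟩, fun s hs => subset_sUnion_of_mem hs⟩
    · rintro t ⟨s, hs, hts⟩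
      exact (hc hs).1 t hts
    · exact (Set.pairwise_sUnion hchain.directedOn).2 fun s hs => (hc hs).2
  choose 𝓕 h𝓕 using hmax
  have h𝓕c : ∀ R A, (𝓕 R A).Countable := fun R A => by
    by_contra h
    exact hcount R A _ h (h𝓕 R A).prop.1 (h𝓕 R A).prop.2
  obtain ⟨J, hJ, hclosed⟩ := exists_countable_closed_under
    (fun l : List ι => ⋃ A ∈ l.toFinset.powerset, ⋃ t ∈ 𝓕 l.toFinset A, (t.1 : Set ι))
    (fun l => (Finset.countable_toSet _).biUnion fun A _ =>
      (h𝓕c _ _).biUnion fun t _ => t.1.countable_toSet)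
  obtain ⟨p, q, hpq, hne⟩ := exists_ne_of_not_metrizableSpace hf hsurj hX hJ
  obtain ⟨K, hK⟩ := exists_separatedOn hf hne
  classical
  let R := K.filter (· ∈ J)
  let A := R.filter (p · = true)
  have hsub : ∀ t ∈ 𝓕 R A, (t.1 : Set ι) ⊆ J := by
    intro t ht i hi
    refine hclosed R.toList (fun i hi => ?_) ?_
    · exact (Finset.mem_filter.1 (Finset.mem_toList.1 hi)).2
    · rw [Finset.toList_toFinset]
      exact Set.mem_biUnion (Finset.mem_coe.2 (Finset.mem_powerset.2 (Finset.filter_subset _ _)))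
        (Set.mem_biUnion ht hi)
  have hKJ : ∀ i ∈ K \ R, i ∉ J := fun i hi hiJ => by
    rw [Finset.mem_sdiff] at hi
    exact hi.2 (Finset.mem_filter.2 ⟨hi.1, hiJ⟩)
  have hgood : Good R A (K, p, q) := by
    refine ⟨hK, fun i hi => ?_⟩
    have : p i = q i := hpq i (Finset.mem_filter.1 hi).2
    cases hpi : p i <;> simp_all [A]
  have hmem : (K, p, q) ∈ 𝓕 R A := by
    have hins := (h𝓕 R A).le_of_ge (y := insert (K, p, q) (𝓕 R A)) ⟨?_, ?_⟩
      (Set.subset_insert _ _)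
    · exact hins (Set.mem_insert _ _)
    · rintro t (rfl | ht)
      · exact hgood
      · exact (h𝓕 R A).prop.1 t ht
    · refine (h𝓕 R A).prop.2.insert fun t ht _ => Finset.disjoint_left.2 fun i hi hit => ?_
      exact hKJ i hi (hsub t ht (Finset.mem_sdiff.1 hit).1)
  refine hK p p (fun _ _ => rfl) (fun i hi => hpq i (hsub _ hmem hi)) rfl

theorem exists_continuous_injective_of_uncountable (hf : Continuous f) [DecidableEq ι]
    {R A : Finset ι} {𝓕 : Set (Finset ι × (ι → Bool) × (ι → Bool))}
    (h𝓕 : ∀ t ∈ 𝓕, SeparatedOn f t.1 t.2.1 t.2.2 ∧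
      ∀ i ∈ R, t.2.1 i = decide (i ∈ A) ∧ t.2.2 i = decide (i ∈ A))
    (hdisj : 𝓕.PairwiseDisjoint fun t => t.1 \ R) {V : Type*} (e : V ↪ 𝓕) :
    ∃ g : (V → Bool) → X, Continuous g ∧ Function.Injective g := by
  classical
  let K : V → Finset ι := fun v => (e v).1.1
  let p : V → ι → Bool := fun v => (e v).1.2.1
  let q : V → ι → Bool := fun v => (e v).1.2.2
  let G : (V → Bool) → ι → Bool := fun y i =>
    if h : ∃ v, i ∈ K v \ R then (if y h.choose then p h.choose i else q h.choose i)
    else decide (i ∈ A)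
  have hG : Continuous G := by
    refine continuous_pi fun i => ?_
    by_cases h : ∃ v, i ∈ K v \ R
    · simp only [G, dif_pos h]
      exact (continuous_of_discreteTopology
        (f := fun b : Bool => if b then p h.choose i else q h.choose i)).comp
          (continuous_apply h.choose)
    · simpa only [G, dif_neg h] using continuous_const
  have hGv : ∀ y v, ∀ i ∈ K v, G y i = if y v then p v i else q v i := by
    intro y v i hi
    by_cases hiR : i ∈ R
    · have h : ¬ ∃ v, i ∈ K v \ R := fun ⟨v, hv⟩ => (Finset.mem_sdiff.1 hv).2 hiR
      obtain ⟨h1, h2⟩ := (h𝓕 _ (e v).2).2 i hiR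
      simp only [G, dif_neg h, p, q, h1, h2, ite_self]
    · have hv : i ∈ K v \ R := Finset.mem_sdiff.2 ⟨hi, hiR⟩
      have h : ∃ v, i ∈ K v \ R := ⟨v, hv⟩
      have hch : h.choose = v := by
        by_contra hne
        refine Finset.disjoint_left.1 (hdisj (e h.choose).2 (e v).2 fun he => hne ?_)
          h.choose_spec hv
        exact e.injective (Subtype.ext he)
      simp only [G, dif_pos h, hch]
  have hsep : ∀ y y' : V → Bool, ∀ v, y v = true → y' v = false → f (G y) ≠ f (G y') := by
    intro y y' v hy hy'
    refine (h𝓕 _ (e v).2).1 _ _ (fun i hi => ?_) (fun i hi => ?_)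
    · rw [hGv y v i hi, hy, if_pos rfl]
    · rw [hGv y' v i hi, hy']
      simp [q]
  refine ⟨f ∘ G, hf.comp hG, fun y y' hyy' => ?_⟩
  by_contra hne
  obtain ⟨v, hv⟩ := Function.ne_iff.1 hne
  cases hy : y v <;> cases hy' : y' v
  · exact hv (hy.trans hy'.symm)
  · exact hsep y' y v hy' hy hyy'.symm
  · exact hsep y y' v hy hy' hyy'
  · exact hv (hy.trans hy'.symm)

end Dyadic

section Branches

variable {Ω : Type*}

/-- The initial segment of length `n` of a sequence. -/
def initialSegment (x : ℕ → Ω) (n : ℕ) : List Ω := (List.range n).map x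

theorem length_initialSegment (x : ℕ → Ω) (n : ℕ) : (initialSegment x n).length = n := by
  simp [initialSegment]

theorem initialSegment_succ (x : ℕ → Ω) (n : ℕ) :
    initialSegment x (n + 1) = initialSegment x n ++ [x n] := by
  simp [initialSegment, List.range_succ]

theorem take_initialSegment (x : ℕ → Ω) {k n : ℕ} (h : k ≤ n) :
    (initialSegment x n).take k = initialSegment x k := by
  rw [initialSegment, ← List.map_take, List.take_range, min_eq_left h, initialSegment]

theorem initialSegment_eq_of_le {x y : ℕ → Ω} {k n : ℕ} (h : k ≤ n)
    (hxy : initialSegment x n = initialSegment y n) :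
    initialSegment x k = initialSegment y k := by
  rw [← take_initialSegment x h, hxy, take_initialSegment y h]

theorem le_of_initialSegment_eq {x y : ℕ → Ω} {k n : ℕ} (hn : x n ≠ y n)
    (hxy : initialSegment x k = initialSegment y k) : k ≤ n := by
  by_contra! hlt
  have := initialSegment_eq_of_le (Nat.succ_le_of_lt hlt) hxy
  rw [Nat.succ_eq_add_one, initialSegment_succ, initialSegment_succ] at this
  exact hn (by simpa using (List.append_inj' this rfl).2)

/-- Any assignment of positions to the branches is constant on infinitely many branches which
split simultaneously at a later position. -/
def SplitsInfinitely {A : Type*} (x : A → ℕ → Ω) : Prop :=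
  ∀ m : A → ℕ, ∃ (B : Set A) (k n : ℕ), B.Infinite ∧ k ≤ n ∧ (∀ δ ∈ B, m δ = k) ∧
    (∀ δ ∈ B, ∀ γ ∈ B, initialSegment (x δ) n = initialSegment (x γ) n) ∧
    B.InjOn fun δ => x δ n

variable [LinearOrder Ω] [WellFoundedLT Ω] [Uncountable Ω]

theorem exists_uncountable_fiber (hΩ : ∀ δ : Ω, (Iio δ).Countable)
    {x : {δ : Ω // (Iio δ).Nonempty} → ℕ → Ω} (hx : ∀ δ, range (x δ) = Iio δ.1)
    (m : {δ : Ω // (Iio δ).Nonempty} → ℕ) :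
    ∃ τ, ¬ {δ | initialSegment (x δ) (m δ) = τ}.Countable := by
  by_contra! h
  have ω₀ : Ω := Classical.arbitrary Ω
  obtain ⟨J, hJ, hclosed⟩ := exists_countable_closed_under
    (fun l : List Ω => {ω₀} ∪ ((⋃ ξ ∈ {ξ | ξ ∈ l}, Iio ξ) ∪
      Subtype.val '' {δ | initialSegment (x δ) (m δ) = l}))
    (fun l => (Set.countable_singleton _).union
      (((List.finite_toSet l).countable.biUnion fun ξ _ => hΩ ξ).union ((h l).image _)))
  have hlower : ∀ ξ ∈ J, Iio ξ ⊆ J := fun ξ hξ η hη =>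
    hclosed [ξ] (by simpa using hξ) (Or.inr (Or.inl (Set.mem_biUnion (by simp) hη)))
  have hne : Jᶜ.Nonempty := by
    rw [Set.nonempty_compl]
    rintro rfl
    exact Set.not_countable_univ hJ
  obtain ⟨δ, hδ, hmin⟩ := WellFounded.has_min (wellFounded_lt (α := Ω)) Jᶜ hne
  have hδJ : Iio δ ⊆ J := fun ξ hξ => by
    by_contra hξJ
    exact hmin ξ hξJ hξ
  have hω₀ : ω₀ ∈ J := hclosed [] (by simp) (Or.inl rfl)
  have hω₀δ : ω₀ < δ := by
    by_contra! hle
    rcases hle.eq_or_lt with rfl | hlt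
    · exact hδ hω₀
    · exact hδ (hlower ω₀ hω₀ hlt)
  let d : {δ : Ω // (Iio δ).Nonempty} := ⟨δ, ω₀, hω₀δ⟩
  refine hδ (hclosed (initialSegment (x d) (m d)) (fun ξ hξ => ?_)
    (Or.inr (Or.inr ⟨d, rfl, rfl⟩)))
  obtain ⟨i, -, rfl⟩ := List.mem_map.1 hξ
  have : x d i ∈ range (x d) := ⟨i, rfl⟩
  rw [hx] at this
  exact hδJ this

theorem splitsInfinitely_of_range_eq_Iio (hΩ : ∀ δ : Ω, (Iio δ).Countable)
    {x : {δ : Ω // (Iio δ).Nonempty} → ℕ → Ω} (hx : ∀ δ, range (x δ) = Iio δ.1) :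
    SplitsInfinitely x := by
  intro m
  obtain ⟨τ, hτ⟩ := exists_uncountable_fiber hΩ hx m
  set E := {δ | initialSegment (x δ) (m δ) = τ}
  have hm : ∀ δ ∈ E, m δ = τ.length := fun δ hδ => by
    rw [← show initialSegment (x δ) (m δ) = τ from hδ, length_initialSegment]
  have hnode : ∀ δ ∈ E, initialSegment (x δ) τ.length = τ := fun δ hδ => by
    rw [← hm δ hδ]
    exact hδ
  by_contra! hno
  have hchild : ∀ n, τ.length ≤ n → ∀ σ,
      ((fun δ => x δ n) '' {δ ∈ E | initialSegment (x δ) n = σ}).Finite := by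
    intro n hn σ
    by_contra hinf
    obtain ⟨B, hB, hbij⟩ := Set.SurjOn.exists_bijOn_subset
      (Set.surjOn_image (fun δ => x δ n) {δ ∈ E | initialSegment (x δ) n = σ})
    refine hno B τ.length n (fun hfin => hinf ?_) hn (fun δ hδ => hm δ (hB hδ).1)
      (fun δ hδ γ hγ => (hB hδ).2.trans (hB hγ).2.symm) hbij.injOn
    rw [← hbij.image_eq]
    exact hfin.image _
  have hlevel : ∀ n, ((fun δ => initialSegment (x δ) n) '' E).Finite := by
    intro n
    induction n with
    | zero => exact (Set.finite_singleton []).subset (by rintro _ ⟨δ, -, rfl⟩; rfl)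
    | succ n ih =>
      rcases Nat.lt_or_ge n τ.length with hn | hn
      · refine (Set.finite_singleton (τ.take (n + 1))).subset ?_
        rintro _ ⟨δ, hδ, rfl⟩
        show initialSegment (x δ) (n + 1) = τ.take (n + 1)
        rw [← take_initialSegment (x δ) (Nat.succ_le_of_lt hn), hnode δ hδ]
      · refine (ih.biUnion fun σ _ => (hchild n hn σ).image fun a => σ ++ [a]).subset ?_
        rintro _ ⟨δ, hδ, rfl⟩
        refine Set.mem_biUnion (Set.mem_image_of_mem _ hδ) ⟨x δ n, ⟨δ, ⟨hδ, rfl⟩, rfl⟩, ?_⟩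
        exact (initialSegment_succ _ _).symm
  have hcount : (⋃ δ ∈ E, Iio δ.1).Countable := by
    refine (Set.countable_iUnion fun n => (hlevel (n + 1)).countable.biUnion fun l _ =>
      (List.finite_toSet l).countable).mono ?_
    intro ξ hξ
    obtain ⟨δ, hδ, hξδ⟩ := Set.mem_iUnion₂.1 hξ
    rw [← hx] at hξδ
    obtain ⟨n, rfl⟩ := hξδ
    refine Set.mem_iUnion.2 ⟨n, Set.mem_biUnion (Set.mem_image_of_mem _ hδ) ?_⟩
    show x δ n ∈ initialSegment (x δ) (n + 1)
    simp [initialSegment_succ]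
  have hsub : (Subtype.val '' E \ ⋃ δ ∈ E, Iio δ.1).Subsingleton := by
    rintro _ ⟨⟨δ, hδ, rfl⟩, hδ'⟩ _ ⟨⟨γ, hγ, rfl⟩, hγ'⟩
    refine le_antisymm ?_ ?_
    · by_contra! hlt
      exact hγ' (Set.mem_biUnion hδ hlt)
    · by_contra! hlt
      exact hδ' (Set.mem_biUnion hγ hlt)
  refine hτ (Set.countable_of_injective_of_countable_image (f := Subtype.val)
    Subtype.val_injective.injOn ?_)
  refine (hcount.union hsub.countable).mono fun ξ hξ => ?_
  by_cases h : ξ ∈ ⋃ δ ∈ E, Iio δ.1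
  · exact Or.inl h
  · exact Or.inr ⟨hξ, h⟩

end Branches

theorem IsSupercompact.of_homeomorph {X Y : Type*} [tX : TopologicalSpace X]
    [tY : TopologicalSpace Y] (e : X ≃ₜ Y) (h : IsSupercompact Y) : IsSupercompact X := by
  obtain ⟨S, hS, hcov⟩ := h
  refine ⟨preimage e '' S, ?_, fun C hC hCX => ?_⟩
  · rw [← induced_generateFrom_eq, hS]
    exact e.isInducing.eq_induced.symm
  · obtain ⟨T, hT, hTfin, hTcard, hTcov⟩ := hcov {U ∈ S | e ⁻¹' U ∈ C} (fun U hU => hU.1) (by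
      refine Set.eq_univ_of_forall fun y => ?_
      obtain ⟨W, hW, hyW⟩ : e.symm y ∈ ⋃₀ C := hCX ▸ Set.mem_univ _
      obtain ⟨U, hU, rfl⟩ := hC hW
      exact ⟨U, ⟨hU, hW⟩, by simpa using hyW⟩)
    refine ⟨preimage e '' T, ?_, hTfin.image _, (Set.ncard_image_le hTfin).trans hTcard, ?_⟩
    · rintro _ ⟨U, hU, rfl⟩
      exact (hT hU).2
    · refine Set.eq_univ_of_forall fun a => ?_
      obtain ⟨U, hU, haU⟩ : e a ∈ ⋃₀ T := hTcov ▸ Set.mem_univ _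
      exact ⟨_, Set.mem_image_of_mem _ hU, haU⟩

/-- A supercompact space has a family of closed sets with the ternary intersection property which
generates all clopen sets under finite unions. -/
theorem IsSupercompact.exists_closed_family {Z : Type*} [TopologicalSpace Z] [CompactSpace Z]
    (h : IsSupercompact Z) :
    ∃ 𝒞 : Set (Set Z), (∀ C ∈ 𝒞, IsClosed C) ∧
      (∀ U, IsClopen U → ∃ 𝓕 ⊆ 𝒞, 𝓕.Finite ∧ ⋃₀ 𝓕 = U) ∧
      ∀ A ∈ 𝒞, ∀ B ∈ 𝒞, ∀ C ∈ 𝒞, (A ∩ B).Nonempty → (A ∩ C).Nonempty → (B ∩ C).Nonempty →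
        (A ∩ B ∩ C).Nonempty := by
  obtain ⟨S, hS, hcov⟩ := h
  have hopen : ∀ s ∈ S, IsOpen s := fun s hs => by
    rw [← hS]
    exact isOpen_generateFrom_of_mem hs
  refine ⟨{A | ∃ W ⊆ S, A = (⋃₀ W)ᶜ}, ?_, ?_, ?_⟩
  · rintro _ ⟨W, hW, rfl⟩
    exact (isOpen_sUnion fun s hs => hopen s (hW hs)).isClosed_compl
  · intro U hU
    have hbasis := isTopologicalBasis_of_subbasis hS.symm
    have hW : ∀ y ∈ Uᶜ, ∃ W : Set (Set Z), W.Finite ∧ W ⊆ S ∧ y ∈ ⋂₀ W ∧ ⋂₀ W ⊆ Uᶜ := by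
      intro y hy
      obtain ⟨_, ⟨W, ⟨hWfin, hWS⟩, rfl⟩, hyW, hWU⟩ :=
        hbasis.exists_subset_of_mem_open hy hU.compl.isOpen
      exact ⟨W, hWfin, hWS, hyW, hWU⟩
    choose! W hWfin hWS hyW hWU using hW
    obtain ⟨Y, hY, hYfin, hYcov⟩ := hU.compl.isClosed.isCompact.elim_finite_subcover_image
      (b := Uᶜ) (c := fun y => ⋂₀ W y)
      (fun y hy => (hWfin y hy).isOpen_sInter fun s hs => hopen s (hWS y hy hs))
      (fun y hy => Set.mem_biUnion hy (hyW y hy))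
    have hfin : (⋃ y ∈ Y, W y).Finite := hYfin.biUnion fun y hy => hWfin y (hY hy)
    refine ⟨(fun z : Z => (⋃₀ {s ∈ ⋃ y ∈ Y, W y | z ∉ s} : Set Z)ᶜ) '' U, ?_, ?_, ?_⟩
    · rintro _ ⟨z, -, rfl⟩
      refine ⟨_, fun s hs => ?_, rfl⟩
      obtain ⟨y, hy, hs⟩ := Set.mem_iUnion₂.1 hs.1
      exact hWS y (hY hy) hs
    · refine (hfin.finite_subsets.image fun W : Set (Set Z) => (⋃₀ W)ᶜ).subset ?_
      rintro _ ⟨z, -, rfl⟩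
      exact Set.mem_image_of_mem (fun W : Set (Set Z) => (⋃₀ W)ᶜ) (fun s hs => hs.1)
    · refine subset_antisymm (Set.sUnion_subset ?_) fun z hz => ?_
      · rintro _ ⟨z, hz, rfl⟩ w hw
        by_contra hwU
        obtain ⟨y, hy, hwy⟩ := Set.mem_iUnion₂.1 (hYcov hwU)
        refine hWU y (hY hy) (fun s hs => ?_) hz
        by_contra hzs
        exact hw ⟨s, ⟨Set.mem_biUnion hy hs, hzs⟩, hwy s hs⟩
      · exact ⟨_, Set.mem_image_of_mem _ hz, fun ⟨s, hs, hzs⟩ => hs.2 hzs⟩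
  · rintro _ ⟨W₁, h₁, rfl⟩ _ ⟨W₂, h₂, rfl⟩ _ ⟨W₃, h₃, rfl⟩ h₁₂ h₁₃ h₂₃
    by_contra hempty
    rw [Set.not_nonempty_iff_eq_empty, ← Set.compl_union, ← Set.compl_union,
      ← Set.sUnion_union, ← Set.sUnion_union, Set.compl_empty_iff] at hempty
    obtain ⟨T, hT, hTfin, hTcard, hTcov⟩ :=
      hcov _ (Set.union_subset (Set.union_subset h₁ h₂) h₃) hempty
    have key : ∀ V W : Set (Set Z), ((⋃₀ V)ᶜ ∩ (⋃₀ W)ᶜ).Nonempty → ∃ s ∈ T, s ∉ V ∧ s ∉ W := by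
      rintro V W ⟨z, hzV, hzW⟩
      obtain ⟨s, hs, hzs⟩ : z ∈ ⋃₀ T := hTcov ▸ Set.mem_univ z
      exact ⟨s, hs, fun h => hzV ⟨s, h, hzs⟩, fun h => hzW ⟨s, h, hzs⟩⟩
    obtain ⟨a, ha, ha₁, ha₂⟩ := key _ _ h₁₂
    obtain ⟨b, hb, hb₁, hb₃⟩ := key _ _ h₁₃
    obtain ⟨c, hc, hc₂, hc₃⟩ := key _ _ h₂₃
    have ha₃ : a ∈ W₃ := (hT ha).resolve_left (not_or.2 ⟨ha₁, ha₂⟩)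
    have hb₂ : b ∈ W₂ := ((hT hb).resolve_right hb₃).resolve_left hb₁
    refine hTcard.not_gt ((Set.two_lt_ncard_iff hTfin).2 ⟨a, b, c, ha, hb, hc, ?_, ?_, ?_⟩)
    · rintro rfl; exact hb₃ ha₃
    · rintro rfl; exact hc₃ ha₃
    · rintro rfl; exact hc₂ hb₂

section Ladder

variable {Ω A : Type*}

/-- The closed subspace of a Cantor cube in which two branches may be selected together only if
one of their common initial segments is selected. -/
def ladderSet (x : A → ℕ → Ω) : Set (List Ω ⊕ A → Bool) :=
  {z | ∀ δ γ, δ ≠ γ → z (Sum.inr δ) = true → z (Sum.inr γ) = true →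
    ∃ k, initialSegment (x δ) k = initialSegment (x γ) k ∧
      z (Sum.inl (initialSegment (x δ) k)) = true}

theorem isClosed_ladderSet {x : A → ℕ → Ω} (hx : Function.Injective x) :
    IsClosed (ladderSet x) := by
  have hclopen : ∀ v : List Ω ⊕ A, IsClopen {z : List Ω ⊕ A → Bool | z v = true} := fun v =>
    (isClopen_discrete {true}).preimage (continuous_apply v)
  simp only [ladderSet, Set.ofPred_forall]
  refine isClosed_iInter fun δ => isClosed_iInter fun γ => isClosed_iInter fun hne => ?_
  obtain ⟨n, hn⟩ := Function.ne_iff.1 (hx.ne hne)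
  have hfin : {k | initialSegment (x δ) k = initialSegment (x γ) k}.Finite :=
    (Set.finite_Iic n).subset fun k hk => le_of_initialSegment_eq hn hk
  convert (hclopen (Sum.inr δ)).compl.isClosed.union
    ((hclopen (Sum.inr γ)).compl.isClosed.union (hfin.isClosed_biUnion fun k _ =>
      (hclopen (Sum.inl (initialSegment (x δ) k))).isClosed)) using 1
  ext z
  simp only [Set.mem_union, Set.mem_compl_iff, Set.mem_ofPred_eq,
    Set.mem_iUnion, exists_prop]
  tauto

theorem not_isSupercompact_ladderSet {x : A → ℕ → Ω} (hx : Function.Injective x)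
    (hsplit : SplitsInfinitely x) : ¬ IsSupercompact (ladderSet x) := by
  classical
  intro h
  have : CompactSpace (ladderSet x) :=
    isCompact_iff_compactSpace.1 (isClosed_ladderSet hx).isCompact
  obtain ⟨𝒞, hclosed, hunion, htern⟩ := h.exists_closed_family
  have hclopen : ∀ v : List Ω ⊕ A, IsClopen {z : ladderSet x | z.1 v = true} := fun v =>
    (isClopen_discrete {true}).preimage ((continuous_apply v).comp continuous_subtype_val)
  let p : List Ω → ladderSet x := fun τ =>
    ⟨Sum.elim (fun σ => decide (σ = τ)) fun δ => decide (∃ k, initialSegment (x δ) k = τ), by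
      intro δ γ _ hδ hγ
      simp only [Sum.elim_inr, decide_eq_true_eq] at hδ hγ
      obtain ⟨k, rfl⟩ := hδ
      obtain ⟨l, hl⟩ := hγ
      have : l = k := by simpa only [length_initialSegment] using congrArg List.length hl
      subst this
      exact ⟨l, hl.symm, by simp⟩⟩
  let q : A → ladderSet x := fun δ => ⟨fun v => decide (v = Sum.inr δ), by
    intro γ γ' hne h h'
    simp only [decide_eq_true_eq, Sum.inr.injEq] at h h'
    exact absurd (h.trans h'.symm) hne⟩
  have hlim : ∀ δ, Filter.Tendsto (fun k => p (initialSegment (x δ) k)) Filter.atTop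
      (𝓝 (q δ)) := by
    intro δ
    refine tendsto_subtype_rng.2 (tendsto_pi_nhds.2 fun v => ?_)
    refine Filter.Tendsto.congr' (f₁ := fun _ => (q δ).1 v) ?_ tendsto_const_nhds
    rcases v with σ | γ
    · filter_upwards [Filter.eventually_gt_atTop σ.length] with k hk
      have : σ ≠ initialSegment (x δ) k := by
        rintro rfl
        simp [length_initialSegment] at hk
      simp [p, q, this]
    · by_cases hγ : γ = δ
      · subst hγ
        exact Filter.Eventually.of_forall fun k => by simp [p, q]
      · obtain ⟨n, hn⟩ := Function.ne_iff.1 (hx.ne hγ)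
        filter_upwards [Filter.eventually_gt_atTop n] with k hk
        have : ∀ l, initialSegment (x γ) l ≠ initialSegment (x δ) k := fun l hl => by
          have : l = k := by simpa only [length_initialSegment] using congrArg List.length hl
          subst this
          exact hk.not_ge (le_of_initialSegment_eq hn hl)
        simp [p, q, this, hγ]
  have hS : ∀ δ, ∃ S ∈ 𝒞, S ⊆ {z | z.1 (Sum.inr δ) = true} ∧ q δ ∈ S ∧
      ∃ k, p (initialSegment (x δ) k) ∈ S := by
    intro δ
    obtain ⟨𝓕, h𝓕, hfin, hU⟩ := hunion _ (hclopen (Sum.inr δ))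
    have hfreq : ∃ S ∈ 𝓕, ∃ᶠ k in Filter.atTop, p (initialSegment (x δ) k) ∈ S := by
      by_contra! hno
      have hev : ∀ᶠ k in Filter.atTop, ∀ S ∈ 𝓕, p (initialSegment (x δ) k) ∉ S :=
        (Filter.eventually_all_finite hfin).2 fun S hS => hno S hS
      obtain ⟨k, hk⟩ := hev.exists
      obtain ⟨S, hS, hkS⟩ : p (initialSegment (x δ) k) ∈ ⋃₀ 𝓕 := by
        rw [hU]
        simp [p]
      exact hk S hS hkS
    obtain ⟨S, hS, hkS⟩ := hfreq
    exact ⟨S, h𝓕 hS, hU ▸ Set.subset_sUnion_of_mem hS,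
      (hclosed S (h𝓕 hS)).mem_of_frequently_of_tendsto hkS (hlim δ), hkS.exists⟩
  choose S hS𝒞 hSU hqS m hpS using hS
  obtain ⟨B, k, n, hB, hkn, hm, hseg, hinj⟩ := hsplit m
  obtain ⟨δ₀, hδ₀⟩ := hB.nonempty
  have hF : IsClopen (⋃ j ∈ Set.Iic n,
      {z : ladderSet x | z.1 (Sum.inl (initialSegment (x δ₀) j)) = true}) :=
    (Set.finite_Iic n).isClopen_biUnion fun j _ => hclopen _
  obtain ⟨𝓖, h𝓖, hfin, hU⟩ := hunion _ hF.compl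
  have hq : ∀ δ, ∃ T ∈ 𝓖, q δ ∈ T := by
    intro δ
    have : q δ ∈ ⋃₀ 𝓖 := by
      rw [hU]
      simp [q]
    exact this
  choose T hT hqT using hq
  obtain ⟨δ, hδ, γ, hγ, hne, hTeq⟩ :=
    hB.exists_ne_map_eq_of_mapsTo (fun δ _ => hT δ) hfin
  obtain ⟨z, ⟨hzδ, hzγ⟩, hzT⟩ := htern (S δ) (hS𝒞 δ) (S γ) (hS𝒞 γ) (T δ) (h𝓖 (hT δ))
    ⟨p (initialSegment (x δ) k), by
      have := hpS δ
      rwa [hm δ hδ] at this, by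
      have := hpS γ
      rwa [hm γ hγ, initialSegment_eq_of_le hkn (hseg γ hγ δ hδ)] at this⟩
    ⟨q δ, hqS δ, hqT δ⟩ ⟨q γ, hqS γ, hTeq ▸ hqT γ⟩
  obtain ⟨l, hl, hzl⟩ := z.2 δ γ hne (hSU δ hzδ) (hSU γ hzγ)
  have hln : l ≤ n := le_of_initialSegment_eq (fun h => hne (hinj hδ hγ h)) hl
  have hzF : z ∈ (⋃ j ∈ Set.Iic n,
      {z : ladderSet x | z.1 (Sum.inl (initialSegment (x δ₀) j)) = true})ᶜ :=
    hU ▸ Set.mem_sUnion_of_mem hzT (hT δ)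
  refine hzF (Set.mem_biUnion hln ?_)
  rw [initialSegment_eq_of_le hln (hseg δ hδ δ₀ hδ₀)] at hzl
  exact hzl

end Ladder

theorem exists_splitsInfinitely : ∃ (Ω A : Type) (x : A → ℕ → Ω), Function.Injective x ∧
    SplitsInfinitely x ∧ Cardinal.mk (List Ω ⊕ A) ≤ Cardinal.aleph 1 := by
  let Ω := (Cardinal.aleph.{0} 1).ord.ToType
  have hmk : Cardinal.mk Ω = Cardinal.aleph 1 := Cardinal.mk_ord_toType _
  have : Uncountable Ω := by
    rw [← Cardinal.aleph0_lt_mk_iff, hmk]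
    exact Cardinal.aleph0_lt_aleph_one
  have hΩ : ∀ δ : Ω, (Iio δ).Countable := fun δ => by
    rw [← Cardinal.le_aleph0_iff_set_countable, ← Cardinal.lt_aleph_one_iff]
    exact (Cardinal.mk_Iio_lt δ (by simp [Ω])).trans_eq hmk
  choose x hx using fun δ : {δ : Ω // (Iio δ).Nonempty} =>
    (hΩ δ.1).exists_eq_range δ.2
  refine ⟨Ω, _, x, fun δ γ h => ?_, splitsInfinitely_of_range_eq_Iio hΩ fun δ => (hx δ).symm, ?_⟩
  · exact Subtype.ext (Set.Iio_injective (by rw [hx, hx, h]))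
  · rw [Cardinal.mk_sum, Cardinal.lift_id, Cardinal.lift_id, Cardinal.mk_list_eq_mk]
    refine Cardinal.add_le_of_le (Cardinal.aleph0_le_aleph 1) hmk.le ?_
    exact (Cardinal.mk_subtype_le _).trans hmk.le

theorem metrizableSpace_of_isHereditarilySupercompact {ι X : Type*} [TopologicalSpace X]
    [CompactSpace X] [T2Space X] {f : (ι → Bool) → X} (hf : Continuous f)
    (hsurj : Function.Surjective f) (h : IsHereditarilySupercompact X) : MetrizableSpace X := by
  classical
  by_contra hX
  obtain ⟨R, A, 𝓕, hcount, h𝓕, hdisj⟩ := exists_uncountable_pairwiseDisjoint hf hsurj hX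
  obtain ⟨Ω, B, x, hx, hsplit, hcard⟩ := exists_splitsInfinitely
  have he : Nonempty (List Ω ⊕ B ↪ 𝓕) := by
    rw [← Cardinal.lift_mk_le']
    refine (Cardinal.lift_le.2 hcard).trans ?_
    rw [Cardinal.lift_aleph, Ordinal.lift_one, Cardinal.aleph_one_le_iff,
      Cardinal.aleph0_lt_lift, ← not_le]
    exact mt Cardinal.le_aleph0_iff_set_countable.1 hcount
  obtain ⟨e⟩ := he
  obtain ⟨g, hg, hginj⟩ := exists_continuous_injective_of_uncountable hf h𝓕 hdisj e
  have hgemb : IsClosedEmbedding g := hg.isClosedEmbedding hginj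
  refine not_isSupercompact_ladderSet hx hsplit ?_
  exact (h _ (hgemb.isClosedMap _ (isClosed_ladderSet hx))).of_homeomorph
    (hgemb.isEmbedding.homeomorphImage _)

/-- A dyadic compact Hausdorff space (a continuous image of a Cantor cube `{0,1}^κ`) is
metrizable if and only if it is hereditarily supercompact. -/
theorem dyadic_metrizable_iff_hereditarilySupercompact
    (X : Type u) [TopologicalSpace X] [CompactSpace X] [T2Space X]
    (hdyadic : ∃ (ι : Type v) (f : (ι → Bool) → X), Continuous f ∧ Function.Surjective f) :
    TopologicalSpace.MetrizableSpace X ↔ IsHereditarilySupercompact X := by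
  obtain ⟨ι, f, hf, hsurj⟩ := hdyadic
  exact ⟨fun _ => isHereditarilySupercompact_of_metrizableSpace X,
    metrizableSpace_of_isHereditarilySupercompact hf hsurj⟩
end

section
/- Let (X_i)_{i∈I} be a family of compact Hausdorff spaces and let αX denote the one-point compactification of the topological sum ⨁_{i∈I} X_i. If each X_i is supercompact, then αX is supercompact; if each X_i is hereditarily supercompact, then αX is hereditarily supercompact. -/
open Set Topology TopologicalSpace

universe u v

/-- Two-set form of the covering condition, for a subbase containing the empty set. -/
theorem IsSupercompact.exists_subbase {X : Type*} [t : TopologicalSpace X]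
    (h : IsSupercompact X) :
    ∃ S : Set (Set X), ∅ ∈ S ∧ TopologicalSpace.generateFrom S = t ∧
      ∀ C ⊆ S, C.Nonempty → ⋃₀ C = univ → ∃ A ∈ C, ∃ B ∈ C, A ∪ B = univ := by
  obtain ⟨S, hS, hcov⟩ := h
  refine ⟨insert ∅ S, mem_insert _ _, ?_, ?_⟩
  · rw [generateFrom_insert_empty, hS]
  · rintro C hC ⟨A₀, hA₀⟩ hun
    obtain ⟨T, hTC, hTf, hT2, hTun⟩ := hcov (C \ {∅}) (by
      rintro A ⟨hA, hne⟩
      exact (hC hA).resolve_left hne) (by rw [sUnion_sdiff_singleton_empty, hun])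
    have hTC' : T ⊆ C := hTC.trans sdiff_subset
    have hcases : T.ncard = 0 ∨ T.ncard = 1 ∨ T.ncard = 2 := by omega
    rcases hcases with h0 | h1 | h2
    · rw [ncard_eq_zero hTf] at h0
      subst h0
      refine ⟨A₀, hA₀, A₀, hA₀, ?_⟩
      rw [sUnion_empty] at hTun
      exact eq_univ_of_univ_subset (hTun ▸ empty_subset _)
    · obtain ⟨A, rfl⟩ := ncard_eq_one.1 h1
      exact ⟨A, hTC' rfl, A, hTC' rfl, by simpa using hTun⟩
    · obtain ⟨A, B, -, rfl⟩ := ncard_eq_two.1 h2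
      exact ⟨A, hTC' (by simp), B, hTC' (by simp), by simpa using hTun⟩

theorem IsSupercompact.of_subbase {X : Type*} [t : TopologicalSpace X] (S : Set (Set X))
    (hS : TopologicalSpace.generateFrom S = t)
    (h : ∀ C ⊆ S, C.Nonempty → ⋃₀ C = univ → ∃ A ∈ C, ∃ B ∈ C, A ∪ B = univ) :
    IsSupercompact X := by
  refine ⟨S, hS, fun C hC hun => ?_⟩
  rcases C.eq_empty_or_nonempty with rfl | hne
  · exact ⟨∅, subset_rfl, finite_empty, by simp, hun⟩
  · obtain ⟨A, hA, B, hB, hAB⟩ := h C hC hne hun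
    refine ⟨{A, B}, ?_, by simp, (ncard_insert_le _ _).trans (by simp), by simpa using hAB⟩
    rintro D (rfl | rfl) <;> assumption

/-- A space made of pairwise disjoint clopen supercompact pieces together with remaining points,
such that every neighborhood of a remaining point contains all but finitely many pieces and all
remaining points, is supercompact, provided that there is a remaining point or that finitely many
pieces cover the space. -/
theorem IsSupercompact.of_isClopenEmbedding {I Y : Type*} {W : I → Type*} [t : TopologicalSpace Y]
    [tW : ∀ i, TopologicalSpace (W i)] (e : ∀ i, W i → Y) (he : ∀ i, IsOpenEmbedding (e i))
    (hcl : ∀ i, IsClosed (range (e i)))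
    (hdisj : ∀ i j, i ≠ j → Disjoint (range (e i)) (range (e j)))
    (hW : ∀ i, IsSupercompact (W i))
    (hfin : (∃ p, ∀ i, p ∉ range (e i)) ∨ ∃ F : Set I, F.Finite ∧ ∀ y, ∃ i ∈ F, y ∈ range (e i))
    (hnhds : ∀ p, (∀ i, p ∉ range (e i)) → ∀ V : Set Y, IsOpen V → p ∈ V →
      ∃ F : Set I, F.Finite ∧ ∀ y ∉ V, ∃ i ∈ F, y ∈ range (e i)) :
    IsSupercompact Y := by
  choose S hS0 hS hcov using fun i => (hW i).exists_subbase
  let P : ∀ i, Set (W i) → Set Y := fun i U => e i '' U ∪ (range (e i))ᶜ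
  let B : Set (Set Y) := {A | ∃ i, ∃ U ∈ S i, A = P i U} ∪
    {A | (∃ p, ∀ i, p ∉ range (e i)) ∧ ∃ i, A = range (e i)}
  have hP : ∀ i, ∀ U ∈ S i, IsOpen[generateFrom B] (P i U) := fun i U hU =>
    isOpen_generateFrom_of_mem (Or.inl ⟨i, U, hU, rfl⟩)
  have hRc : ∀ i, IsOpen[generateFrom B] (range (e i))ᶜ := fun i => by
    simpa [P] using hP i ∅ (hS0 i)
  have hR : ∀ i, IsOpen[generateFrom B] (range (e i)) := by
    intro i
    by_cases hp : ∃ p, ∀ i, p ∉ range (e i)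
    · exact isOpen_generateFrom_of_mem (Or.inr ⟨hp, i, rfl⟩)
    · obtain ⟨F, hF, hFun⟩ := hfin.resolve_left hp
      have heq : range (e i) = ⋂ j ∈ F \ {i}, (range (e j))ᶜ := by
        ext y
        simp only [mem_iInter, mem_compl_iff]
        constructor
        · rintro hy j ⟨-, hji⟩ hyj
          exact disjoint_left.1 (hdisj j i hji) hyj hy
        · intro hy
          obtain ⟨j, hj, hyj⟩ := hFun y
          by_cases hji : j = i
          · exact hji ▸ hyj
          · exact absurd hyj (hy j ⟨hj, hji⟩)
      rw [heq]
      let _ := generateFrom B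
      exact (hF.subset sdiff_subset).isOpen_biInter fun j _ => hRc j
  have himg : ∀ i, ∀ U : Set (W i), IsOpen U → IsOpen[generateFrom B] (e i '' U) := by
    intro i U hU
    have hinj := (he i).injective
    let _ := generateFrom B
    rw [← hS i] at hU
    induction hU with
    | basic U hU =>
      have heq : e i '' U = P i U ∩ range (e i) := by
        rw [union_inter_distrib_right, compl_inter_self, union_empty,
          inter_eq_left.2 (image_subset_range _ _)]
      rw [heq]
      exact (hP i U hU).inter (hR i)
    | univ => simpa using hR i
    | inter U V _ _ hU hV =>
      rw [image_inter hinj]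
      exact hU.inter hV
    | sUnion Q _ hQ =>
      rw [sUnion_eq_biUnion, image_iUnion₂]
      exact isOpen_biUnion hQ
  refine .of_subbase B (le_antisymm ?_ ?_) ?_
  · intro V hV
    refine (@isOpen_iff_forall_mem_open _ (generateFrom B) V).2 fun y hy => ?_
    by_cases hyR : ∃ i, y ∈ range (e i)
    · obtain ⟨i, x, rfl⟩ := hyR
      exact ⟨e i '' (e i ⁻¹' V), image_preimage_subset _ _,
        himg i _ (hV.preimage (he i).continuous), mem_image_of_mem _ hy⟩
    · push Not at hyR
      obtain ⟨F, hF, hFV⟩ := hnhds y hyR V hV hy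
      let _ := generateFrom B
      refine ⟨⋂ j ∈ F, (range (e j))ᶜ, fun z hz => ?_, hF.isOpen_biInter fun j _ => hRc j,
        mem_iInter₂.2 fun j _ => hyR j⟩
      by_contra hzV
      obtain ⟨j, hj, hzj⟩ := hFV z hzV
      exact mem_iInter₂.1 hz j hj hzj
  · refine le_generateFrom ?_
    rintro A (⟨i, U, hU, rfl⟩ | ⟨-, i, rfl⟩)
    · refine ((he i).isOpenMap U ?_).union (hcl i).isOpen_compl
      rw [← hS i]
      exact isOpen_generateFrom_of_mem hU
    · exact (he i).isOpen_range
  · intro C hC hne hun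
    have hstar : ∃ i, ∃ U ∈ S i, P i U ∈ C := by
      by_cases hp : ∃ p, ∀ i, p ∉ range (e i)
      · obtain ⟨p, hp⟩ := hp
        obtain ⟨A, hA, hpA⟩ := mem_sUnion.1 (hun ▸ mem_univ p)
        rcases hC hA with ⟨i, U, hU, rfl⟩ | ⟨-, i, rfl⟩
        · exact ⟨i, U, hU, hA⟩
        · exact absurd hpA (hp i)
      · obtain ⟨A, hA⟩ := hne
        rcases hC hA with ⟨i, U, hU, rfl⟩ | ⟨hp', -⟩
        · exact ⟨i, U, hU, hA⟩
        · exact absurd hp' hp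
    obtain ⟨i, U, hU, hUC⟩ := hstar
    by_cases hRC : range (e i) ∈ C
    · refine ⟨_, hRC, _, hUC, eq_univ_of_forall fun y => ?_⟩
      by_cases hy : y ∈ range (e i)
      · exact Or.inl hy
      · exact Or.inr (Or.inr hy)
    by_cases hj : ∃ j, j ≠ i ∧ ∃ V ∈ S j, P j V ∈ C
    · obtain ⟨j, hji, V, -, hVC⟩ := hj
      refine ⟨_, hVC, _, hUC, eq_univ_of_forall fun y => ?_⟩
      by_cases hy : y ∈ range (e i)
      · exact Or.inl (Or.inr (disjoint_right.1 (hdisj j i hji) hy))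
      · exact Or.inr (Or.inr hy)
    have hcovi : ⋃₀ {V | V ∈ S i ∧ P i V ∈ C} = univ := by
      refine eq_univ_of_forall fun x => ?_
      obtain ⟨A, hA, hxA⟩ := mem_sUnion.1 (hun ▸ mem_univ (e i x))
      rcases hC hA with ⟨j, V, hV, rfl⟩ | ⟨-, j, rfl⟩
      · by_cases hji : j = i
        · subst hji
          rcases hxA with hx | hx
          · exact ⟨V, ⟨hV, hA⟩, (he j).injective.mem_set_image.1 hx⟩
          · exact absurd (mem_range_self x) hx
        · exact absurd ⟨j, hji, V, hV, hA⟩ hj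
      · by_cases hji : j = i
        · exact absurd (hji ▸ hA) hRC
        · exact absurd (mem_range_self x) (disjoint_left.1 (hdisj j i hji) hxA)
    obtain ⟨V₁, h₁, V₂, h₂, h₁₂⟩ := hcov i {V | V ∈ S i ∧ P i V ∈ C}
      (fun V hV => hV.1) ⟨U, hU, hUC⟩ hcovi
    refine ⟨_, h₁.2, _, h₂.2, eq_univ_of_forall fun y => ?_⟩
    by_cases hy : y ∈ range (e i)
    · obtain ⟨x, rfl⟩ := hy
      rcases h₁₂.symm ▸ mem_univ x with hx | hx
      · exact Or.inl (Or.inl (mem_image_of_mem _ hx))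
      · exact Or.inr (Or.inl (mem_image_of_mem _ hx))
    · exact Or.inl (Or.inr hy)

section OnePointSigma

variable {I : Type*} {X : I → Type*} [∀ i, TopologicalSpace (X i)]

/-- A neighborhood of `∞` contains all but finitely many summands. -/
theorem OnePoint.exists_finite_sigma_of_isOpen {V : Set (OnePoint (Σ i, X i))} (hV : IsOpen V)
    (hinf : OnePoint.infty ∈ V) :
    ∃ F : Set I, F.Finite ∧ ∀ i, ∀ x : X i, ((⟨i, x⟩ : Σ i, X i) : OnePoint (Σ i, X i)) ∉ V →
      i ∈ F := by
  have hK := ((OnePoint.isOpen_iff_of_mem hinf).1 hV).2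
  obtain ⟨F, hF⟩ := hK.elim_finite_subcover (fun i => range (Sigma.mk i))
    (fun i => isOpen_range_sigmaMk) (fun y _ => mem_iUnion.2 ⟨y.1, y.2, rfl⟩)
  refine ⟨F, F.finite_toSet, fun i x hx => ?_⟩
  obtain ⟨j, hj, z, hz⟩ := mem_iUnion₂.1 (hF (show (⟨i, x⟩ : Σ i, X i) ∈ _ from hx))
  obtain rfl : j = i := congrArg Sigma.fst hz
  exact hj

theorem OnePoint.isOpenEmbedding_coe_sigmaMk (i : I) :
    IsOpenEmbedding fun x : X i => ((⟨i, x⟩ : Σ i, X i) : OnePoint (Σ i, X i)) :=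
  OnePoint.isOpenEmbedding_coe.comp .sigmaMk

theorem OnePoint.isClosed_range_coe_sigmaMk [∀ i, CompactSpace (X i)] (i : I) :
    IsClosed (range fun x : X i => ((⟨i, x⟩ : Σ i, X i) : OnePoint (Σ i, X i))) := by
  change IsClosed (range ((fun z : Σ i, X i => (z : OnePoint (Σ i, X i))) ∘ Sigma.mk i))
  rw [range_comp, OnePoint.isClosed_image_coe]
  exact ⟨isClosed_range_sigmaMk, isCompact_range continuous_sigmaMk⟩

theorem IsSupercompact.of_isClosedEmbedding_onePoint_sigma [∀ i, CompactSpace (X i)]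
    {Y : Type*} [TopologicalSpace Y] {g : Y → OnePoint (Σ i, X i)} (hg : IsClosedEmbedding g)
    {W : I → Type*} [∀ i, TopologicalSpace (W i)] {e : ∀ i, W i → Y} {c : ∀ i, W i → X i}
    (hc : ∀ i, IsEmbedding (c i))
    (hgc : ∀ i w, g (e i w) = ((⟨i, c i w⟩ : Σ i, X i) : OnePoint (Σ i, X i)))
    (hrange : ∀ i (x : X i) y, g y = ((⟨i, x⟩ : Σ i, X i) : OnePoint (Σ i, X i)) → y ∈ range (e i))
    (hW : ∀ i, IsSupercompact (W i)) : IsSupercompact Y := by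
  have hr : ∀ i, range (e i) =
      g ⁻¹' range fun x : X i => ((⟨i, x⟩ : Σ i, X i) : OnePoint (Σ i, X i)) := by
    intro i
    ext y
    constructor
    · rintro ⟨w, rfl⟩
      exact ⟨c i w, (hgc i w).symm⟩
    · rintro ⟨x, hx⟩
      exact hrange i x y hx.symm
  have hpt : ∀ y, (∀ i, y ∉ range (e i)) → g y = OnePoint.infty := by
    intro y hy
    induction hgy : g y using OnePoint.rec with
    | infty => rfl
    | coe z => exact absurd (hrange z.1 z.2 y hgy) (hy z.1)
  have hopen : ∀ V : Set (OnePoint (Σ i, X i)), IsOpen V → OnePoint.infty ∈ V →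
      ∃ F : Set I, F.Finite ∧ ∀ y, g y ∉ V → ∃ i ∈ F, y ∈ range (e i) := by
    intro V hV hinf
    obtain ⟨F, hF, hFV⟩ := OnePoint.exists_finite_sigma_of_isOpen hV hinf
    refine ⟨F, hF, fun y hy => ?_⟩
    by_cases hyR : ∃ i, y ∈ range (e i)
    · obtain ⟨i, w, rfl⟩ := hyR
      exact ⟨i, hFV i (c i w) (hgc i w ▸ hy), w, rfl⟩
    · push Not at hyR
      exact absurd (hpt y hyR ▸ hinf) hy
  refine .of_isClopenEmbedding e (fun i => ⟨?_, ?_⟩) (fun i => ?_) (fun i j hij => ?_) hW ?_ ?_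
  · refine (hg.isEmbedding.of_comp_iff).1 ?_
    have heq : g ∘ e i = (fun x : X i => ((⟨i, x⟩ : Σ i, X i) : OnePoint (Σ i, X i))) ∘ c i :=
      funext (hgc i)
    rw [heq]
    exact (OnePoint.isOpenEmbedding_coe_sigmaMk i).isEmbedding.comp (hc i)
  · rw [hr]
    exact (OnePoint.isOpenEmbedding_coe_sigmaMk i).isOpen_range.preimage hg.continuous
  · rw [hr]
    exact (OnePoint.isClosed_range_coe_sigmaMk i).preimage hg.continuous
  · rw [disjoint_left]
    rintro _ ⟨w, rfl⟩ ⟨w', hw'⟩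
    have h := (hgc j w').symm.trans ((congrArg g hw').trans (hgc i w))
    exact hij (congrArg Sigma.fst (OnePoint.coe_injective h)).symm
  · by_cases hinf : OnePoint.infty ∈ range g
    · obtain ⟨p, hp⟩ := hinf
      refine Or.inl ⟨p, fun i hi => ?_⟩
      obtain ⟨w, rfl⟩ := hi
      exact OnePoint.coe_ne_infty _ ((hgc i w).symm.trans hp)
    · obtain ⟨F, hF, hFV⟩ := hopen (range g)ᶜ hg.isClosed_range.isOpen_compl hinf
      exact Or.inr ⟨F, hF, fun y => hFV y (not_not.2 (mem_range_self y))⟩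
  · intro p hp V hV hpV
    obtain ⟨V', hV', rfl⟩ := hg.isInducing.isOpen_iff.1 hV
    exact hopen V' hV' (hpt p hp ▸ hpV)

end OnePointSigma

/-- For a family of compact Hausdorff spaces `X i`, the one-point compactification
`α(⨁ᵢ Xᵢ)` of their topological sum is supercompact provided each `X i` is supercompact,
and hereditarily supercompact provided each `X i` is hereditarily supercompact. -/
theorem onePoint_sigma_supercompact
    (I : Type u) (X : I → Type v) [∀ i, TopologicalSpace (X i)]
    [∀ i, CompactSpace (X i)] [∀ i, T2Space (X i)] :
    ((∀ i, IsSupercompact (X i)) → IsSupercompact (OnePoint (Σ i, X i))) ∧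
    ((∀ i, IsHereditarilySupercompact (X i)) →
      IsHereditarilySupercompact (OnePoint (Σ i, X i))) := by
  refine ⟨fun h => ?_, fun h Z hZ => ?_⟩
  · exact .of_isClosedEmbedding_onePoint_sigma (g := id) .id
      (e := fun i x => ((⟨i, x⟩ : Σ i, X i) : OnePoint (Σ i, X i))) (c := fun i => id)
      (fun i => .id) (fun i w => rfl) (fun i x y hy => ⟨x, hy.symm⟩) h
  · let K : ∀ i, Set (X i) := fun i => {x | ((⟨i, x⟩ : Σ i, X i) : OnePoint (Σ i, X i)) ∈ Z}
    have hK : ∀ i, IsClosed (K i) := fun i =>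
      hZ.preimage (OnePoint.isOpenEmbedding_coe_sigmaMk i).continuous
    exact .of_isClosedEmbedding_onePoint_sigma (g := ((↑) : Z → OnePoint (Σ i, X i)))
      hZ.isClosedEmbedding_subtypeVal (W := fun i => K i)
      (e := fun i x => ⟨((⟨i, x.1⟩ : Σ i, X i) : OnePoint (Σ i, X i)), x.2⟩)
      (c := fun i => Subtype.val) (fun i => .subtypeVal) (fun i w => rfl)
      (fun i x y hy => ⟨⟨x, show _ ∈ Z from hy ▸ y.2⟩, Subtype.ext hy.symm⟩)
      (fun i => h i (K i) (hK i))
end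

section
/- Assume Martin's Axiom together with the negation of the Continuum Hypothesis (ω₁ < 𝔠). Then a scattered compact Hausdorff space is metrizable if and only if it is separable and hereditarily supercompact. -/
open Set Topology TopologicalSpace

universe u

/-- A topological space is *scattered* if every nonempty subspace has an isolated point. -/
def IsScatteredSpace (X : Type*) [TopologicalSpace X] : Prop :=
  ∀ A : Set X, A.Nonempty → ∃ a ∈ A, ∃ U : Set X, IsOpen U ∧ U ∩ A = {a}

/-- Martin's Axiom: for every nonempty ccc partial order `P` (every antichain is countable)
and every family `𝒟` of fewer than `𝔠` dense subsets of `P` there is a filter on `P`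
meeting every member of `𝒟`. -/
def MartinsAxiom : Prop :=
  ∀ (P : Type) (_ : PartialOrder P), Nonempty P →
    (∀ A : Set P, (∀ p ∈ A, ∀ q ∈ A, p ≠ q → ¬ ∃ r, r ≤ p ∧ r ≤ q) → A.Countable) →
    ∀ 𝒟 : Set (Set P), Cardinal.mk 𝒟 < Cardinal.continuum →
      (∀ D ∈ 𝒟, ∀ p : P, ∃ q ∈ D, q ≤ p) →
      ∃ G : Set P, G.Nonempty ∧
        (∀ p ∈ G, ∀ q : P, p ≤ q → q ∈ G) ∧
        (∀ p ∈ G, ∀ q ∈ G, ∃ r ∈ G, r ≤ p ∧ r ≤ q) ∧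
        (∀ D ∈ 𝒟, (G ∩ D).Nonempty)

/-- In a space with a binary open subbase `S`, the complements of a subfamily of `S` have a common
point as soon as any two of them meet. -/
theorem exists_forall_notMem_of_linked {Z : Type*} [Nonempty Z] {S C : Set (Set Z)}
    (hS : ∀ C ⊆ S, ⋃₀ C = univ → ∃ T ⊆ C, T.Finite ∧ T.ncard ≤ 2 ∧ ⋃₀ T = univ)
    (hC : C ⊆ S) (h : ∀ s ∈ C, ∀ t ∈ C, ∃ z, z ∉ s ∧ z ∉ t) : ∃ z, ∀ s ∈ C, z ∉ s := by
  by_contra! hcon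
  obtain ⟨T, hTC, hTf, hT2, hT⟩ := hS C hC (eq_univ_of_forall fun z => by
    obtain ⟨s, hs, hz⟩ := hcon z
    exact ⟨s, hs, hz⟩)
  have key : ∀ s t : Set Z, s ∈ C → t ∈ C → T ⊆ {s, t} → False := by
    intro s t hs ht hsub
    obtain ⟨z, hzs, hzt⟩ := h s hs t ht
    obtain ⟨u, hu, hzu⟩ : z ∈ ⋃₀ T := hT ▸ mem_univ z
    rcases hsub hu with rfl | rfl
    · exact hzs hzu
    · exact hzt hzu
  obtain ⟨z⟩ := ‹Nonempty Z›
  obtain ⟨s, hs, -⟩ : z ∈ ⋃₀ T := hT ▸ mem_univ z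
  by_cases hsub : T ⊆ {s}
  · exact key s s (hTC hs) (hTC hs) (by simpa using hsub)
  · obtain ⟨t, ht, hts⟩ := not_subset.1 hsub
    refine key s t (hTC hs) (hTC ht) ?_
    have hst : s ≠ t := fun h => hts (by simp [h])
    have hsub2 : ({s, t} : Set (Set Z)) ⊆ T := by
      rintro u (rfl | rfl)
      exacts [hs, ht]
    exact (Set.eq_of_subset_of_ncard_le hsub2 (by rw [ncard_pair hst]; exact hT2) hTf).ge

/-- A clopen subset of a compact space is determined by finitely many members of a subbase. -/
theorem IsClopen.exists_finite_subbase {Z : Type*} [t : TopologicalSpace Z] [CompactSpace Z]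
    {S : Set (Set Z)} (hS : generateFrom S = t) {V : Set Z} (hV : IsClopen V) :
    ∃ F ⊆ S, F.Finite ∧ ∀ z ∈ V, ∀ w, (∀ s ∈ F, z ∉ s → w ∉ s) → w ∈ V := by
  have hb := isTopologicalBasis_of_subbasis hS.symm
  have hloc : ∀ w : Z, ∃ f : Set (Set Z), f.Finite ∧ f ⊆ S ∧ w ∈ ⋂₀ f ∧ (w ∈ Vᶜ → ⋂₀ f ⊆ Vᶜ) := by
    intro w
    by_cases hw : w ∈ Vᶜ
    · obtain ⟨_, ⟨f, ⟨hf, hfS⟩, rfl⟩, hwf, hsub⟩ :=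
        hb.exists_subset_of_mem_open hw hV.compl.isOpen
      exact ⟨f, hf, hfS, hwf, fun _ => hsub⟩
    · exact ⟨∅, finite_empty, empty_subset _, by simp, fun h => absurd h hw⟩
  choose f hf hfS hwf hsub using hloc
  obtain ⟨T, hT⟩ := hV.compl.isClosed.isCompact.elim_nhds_subcover' (fun w _ => ⋂₀ f w)
    (fun w _ => (hb.isOpen ⟨f w, ⟨hf w, hfS w⟩, rfl⟩).mem_nhds (hwf w))
  refine ⟨⋃ w ∈ T, f w, iUnion₂_subset fun w _ => hfS w,
    T.finite_toSet.biUnion fun w _ => hf w, ?_⟩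
  intro z hz w hw
  by_contra hwV
  obtain ⟨w', hw', hww'⟩ := mem_iUnion₂.1 (hT hwV)
  refine hsub w' w'.2 (show z ∈ ⋂₀ f w' from fun s hs => ?_) hz
  by_contra hzs
  exact hw s (mem_iUnion₂.2 ⟨w', hw', hs⟩) hzs (hww' s hs)

theorem not_isSupercompact_of_treeLike {Z κ J : Type*} [TopologicalSpace Z] [CompactSpace Z]
    [Countable κ] [Uncountable J] {e : κ → Z} (he : DenseRange e) {V : J → Set Z}
    (hV : ∀ α, IsClopen (V α)) (hinf : ∀ α, {k | e k ∈ V α}.Infinite)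
    (hfin : ∀ α β, α ≠ β → {k | e k ∈ V α ∧ e k ∈ V β}.Finite)
    (htree : ∀ B : Set J, ¬ B.Countable → ∃ r ∈ B, ∃ f : ℕ → J, (∀ n, f n ∈ B ∧ f n ≠ r) ∧
      ∀ m n, m < n → ∀ k, e k ∈ V (f m) → e k ∈ V (f n) → e k ∈ V r) :
    ¬ IsSupercompact Z := by
  rintro ⟨S, hS, hbin⟩
  choose F hFS hFf hF using fun α => (hV α).exists_finite_subbase hS
  choose F' hFS' hFf' hF' using fun α => (hV α).compl.exists_finite_subbase hS
  have hT : ∀ α, ∃ T ⊆ F α, {k | e k ∈ V α ∧ {s ∈ F α | e k ∉ s} = T}.Infinite := by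
    intro α
    by_contra! hcon
    refine hinf α (((hFf α).finite_subsets.biUnion fun T hT => hcon T hT).subset ?_)
    intro k hk
    exact mem_iUnion₂.2 ⟨{s ∈ F α | e k ∉ s}, fun s hs => hs.1, hk, rfl⟩
  choose T hTF hTinf using hT
  choose c hc using fun α => (hTinf α).nonempty
  obtain ⟨n, hn⟩ : ∃ n, ¬ (c ⁻¹' {n}).Countable := by
    by_contra! hcon
    refine not_countable_univ (α := J) ((countable_iUnion hcon).mono fun α _ => ?_)
    exact mem_iUnion.2 ⟨c α, rfl⟩
  obtain ⟨r, hr, f, hf, hfr⟩ := htree _ hn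
  have hz : ∀ i, ∃ k, {s ∈ F (f i) | e k ∉ s} = T (f i) ∧ e k ∉ V r := by
    intro i
    obtain ⟨k, hk, hk'⟩ := ((hTinf (f i)).sdiff (hfin (f i) r (hf i).2)).nonempty
    exact ⟨k, hk.2, fun h => hk' ⟨hk.1, h⟩⟩
  choose z hzT hzr using hz
  obtain ⟨i, j, hij, hijF⟩ : ∃ i j, i < j ∧
      {s ∈ F' r | e (z i) ∉ s} = {s ∈ F' r | e (z j) ∉ s} := by
    have hfinite := (hFf' r).finite_subsets
    have := hfinite.to_subtype
    obtain ⟨i, j, hne, hij⟩ := Finite.exists_ne_map_eq_of_infinite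
      (fun i => (⟨{s ∈ F' r | e (z i) ∉ s}, fun s hs => hs.1⟩ : {T | T ⊆ F' r}))
    have hij := congrArg Subtype.val hij
    rcases lt_or_gt_of_ne hne with h | h
    · exact ⟨i, j, h, hij⟩
    · exact ⟨j, i, h, hij.symm⟩
  have hn : ∀ l, ∀ s ∈ T (f l), e n ∉ s := by
    intro l s hs
    have h1 := (hc (f l)).2
    have h2 : c (f l) = n := (hf l).1
    rw [h2] at h1
    rw [← h1] at hs
    exact hs.2
  have hzl : ∀ l, ∀ s ∈ T (f l), e (z l) ∉ s := by
    intro l s hs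
    rw [← hzT] at hs
    exact hs.2
  have hR : ∀ s ∈ {s ∈ F' r | e (z i) ∉ s}, e (z j) ∉ s := by
    intro s hs
    rw [hijF] at hs
    exact hs.2
  have : Nonempty Z := ⟨e n⟩
  obtain ⟨w, hw⟩ := exists_forall_notMem_of_linked hbin
    (C := T (f i) ∪ T (f j) ∪ {s ∈ F' r | e (z i) ∉ s})
    (union_subset (union_subset ((hTF _).trans (hFS _)) ((hTF _).trans (hFS _)))
      (fun s hs => hFS' r hs.1)) (by
      rintro s ((hs | hs) | hs) t ((ht | ht) | ht)
      · exact ⟨e n, hn _ s hs, hn _ t ht⟩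
      · exact ⟨e n, hn _ s hs, hn _ t ht⟩
      · exact ⟨e (z i), hzl _ s hs, ht.2⟩
      · exact ⟨e n, hn _ s hs, hn _ t ht⟩
      · exact ⟨e n, hn _ s hs, hn _ t ht⟩
      · exact ⟨e (z j), hzl _ s hs, hR t ht⟩
      · exact ⟨e (z i), hs.2, hzl _ t ht⟩
      · exact ⟨e (z j), hR s hs, hzl _ t ht⟩
      · exact ⟨e (z i), hs.2, ht.2⟩)
  have hwV : ∀ l, (∀ s ∈ T (f l), w ∉ s) → w ∈ V (f l) := by
    intro l hl
    refine hF (f l) _ (hc (f l)).1 w fun s hs hks => hl s ?_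
    rw [← (hc (f l)).2]
    exact ⟨hs, hks⟩
  have hwi : w ∈ V (f i) := hwV i fun s hs => hw s (.inl (.inl hs))
  have hwj : w ∈ V (f j) := hwV j fun s hs => hw s (.inl (.inr hs))
  have hwr : w ∈ (V r)ᶜ := hF' r _ (hzr i) w fun s hs hs' => hw s (.inr ⟨hs, hs'⟩)
  obtain ⟨k, hk⟩ := he.exists_mem_open
    (((hV (f i)).isOpen.inter (hV (f j)).isOpen).inter (hV r).compl.isOpen) ⟨w, ⟨hwi, hwj⟩, hwr⟩
  exact hk.2 (hfr i j hij k hk.1.1 hk.1.2)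

theorem exists_treeLike_sequence {J : Type*} {p : J → Set ℕ} (hp : p.Injective) {a : Set ℕ}
    (hpa : ∀ α β, ∀ k ∈ a, k ∈ p α → k ∈ p β → ∀ i ≤ k, i ∈ p α ↔ i ∈ p β)
    {B : Set J} (hB : ¬ B.Countable) : ∃ r ∈ B, ∃ f : ℕ → J, (∀ n, f n ∈ B ∧ f n ≠ r) ∧
      ∀ m n, m < n → ∀ k ∈ a, k ∈ p (f m) → k ∈ p (f n) → k ∈ p r := by
  classical
  obtain ⟨r, hrB, hr⟩ : ∃ r ∈ B, ∀ m, ∃ β ∈ B, β ≠ r ∧ ∀ i ≤ m, i ∈ p β ↔ i ∈ p r := by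
    by_contra! hcon
    choose! m hm using hcon
    refine hB (MapsTo.countable_of_injOn
      (f := fun r => (m r, (Finset.range (m r + 1)).filter (· ∈ p r)))
      (t := univ) (fun _ _ => mem_univ _) ?_ countable_univ)
    intro r hr β hβ heq
    by_contra hne
    obtain ⟨i, hi, hi'⟩ := hm β hβ r hr hne
    simp only [Prod.mk.injEq] at heq
    have h2 := heq.2
    rw [heq.1] at h2
    have := Finset.ext_iff.1 h2 i
    simp only [Finset.mem_filter, Finset.mem_range] at this
    have hlt : i < m β + 1 := by omega
    grind
  refine ⟨r, hrB, ?_⟩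
  obtain ⟨f, hf, hf'⟩ := exists_seq_of_forall_finset_exists (fun β => β ∈ B ∧ β ≠ r)
    (fun α β => ∃ d, ¬ (d ∈ p α ↔ d ∈ p r) ∧ ∀ i ≤ d, i ∈ p β ↔ i ∈ p r) (by
      intro s hs
      have : ∀ α, ∃ d, α ≠ r → ¬ (d ∈ p α ↔ d ∈ p r) := by
        intro α
        by_cases h : α = r
        · exact ⟨0, fun h' => absurd h h'⟩
        · by_contra! hcon
          exact h (hp (Set.ext fun d => (hcon d).2))
      choose d hd using this
      obtain ⟨β, hβ, hβr, hβ'⟩ := hr (s.sup d)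
      exact ⟨β, ⟨hβ, hβr⟩, fun α hα => ⟨d α, hd α (hs α hα).2, fun i hi =>
        hβ' i (hi.trans (Finset.le_sup hα))⟩⟩)
  refine ⟨f, hf, fun m n hmn k hk hkm hkn => ?_⟩
  obtain ⟨d, hd, hd'⟩ := hf' m n hmn
  have h1 := hpa _ _ k hk hkm hkn
  by_cases hdk : d ≤ k
  · exact absurd ((h1 d hdk).trans (hd' d le_rfl)) hd
  · exact (hd' k (by omega)).1 hkn

theorem exists_wellOrder_aleph_one : ∃ (I : Type) (_ : LinearOrder I), WellFoundedLT I ∧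
    Cardinal.mk I = Cardinal.aleph 1 ∧ (∀ α : I, (Iio α).Countable) ∧
    ∀ s : Set I, s.Countable → ∃ β, ∀ α ∈ s, α < β := by
  have hI : Cardinal.mk (Cardinal.aleph 1).ord.ToType = Cardinal.aleph 1 := Cardinal.mk_ord_toType _
  have hseg : ∀ α : (Cardinal.aleph 1).ord.ToType, (Iio α).Countable := by
    intro α
    rw [← Cardinal.le_aleph0_iff_set_countable, ← Cardinal.lt_aleph_one_iff]
    exact (Cardinal.mk_Iio_lt α (by rw [hI, Ordinal.type_toType])).trans_eq hI
  refine ⟨(Cardinal.aleph 1).ord.ToType, inferInstance, inferInstance, hI, hseg, ?_⟩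
  intro s hs
  by_contra! hcon
  have hunion : (univ : Set (Cardinal.aleph 1).ord.ToType) ⊆ ⋃ α ∈ s, insert α (Iio α) := by
    intro β _
    obtain ⟨α, hα, hβ⟩ := hcon β
    refine mem_iUnion₂.2 ⟨α, hα, ?_⟩
    rcases hβ.eq_or_lt with h | h
    · exact .inl h
    · exact .inr h
  have hc : (univ : Set (Cardinal.aleph 1).ord.ToType).Countable :=
    (hs.biUnion fun α _ => (hseg α).insert α).mono hunion
  rw [← Cardinal.le_aleph0_iff_set_countable, Cardinal.mk_univ, hI] at hc
  exact absurd Cardinal.aleph0_lt_aleph_one hc.not_gt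

theorem exists_transfinite_sequence {I Y : Type*} [LinearOrder I] [WellFoundedLT I]
    (hseg : ∀ α : I, (Iio α).Countable) {P : Y → Prop} {r : Y → Y → Prop}
    (h : ∀ s : Set Y, s.Countable → (∀ y ∈ s, P y) → ∃ y, P y ∧ ∀ z ∈ s, r z y) :
    ∃ f : I → Y, (∀ α, P (f α)) ∧ ∀ α β, α < β → r (f α) (f β) := by
  classical
  obtain ⟨y₀, -⟩ := h ∅ countable_empty (by simp)
  have h' : ∀ s : Set Y, ∃ y, s.Countable → (∀ y ∈ s, P y) → P y ∧ ∀ z ∈ s, r z y := by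
    intro s
    by_cases hs : s.Countable ∧ ∀ y ∈ s, P y
    · obtain ⟨y, hy⟩ := h s hs.1 hs.2
      exact ⟨y, fun _ _ => hy⟩
    · exact ⟨y₀, fun h1 h2 => absurd ⟨h1, h2⟩ hs⟩
  choose g hg using h'
  let f : I → Y := WellFounded.fix (wellFounded_lt (α := I))
    fun α ih => g (range fun β : Iio α => ih β.1 β.2)
  have hf : ∀ α, f α = g (f '' Iio α) := by
    intro α
    have := WellFounded.fix_eq (wellFounded_lt (α := I))
      (fun α ih => g (range fun β : Iio α => ih β.1 β.2)) α
    rw [image_eq_range]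
    exact this
  have hP : ∀ α, P (f α) ∧ ∀ z ∈ f '' Iio α, r z (f α) := by
    intro α
    induction α using WellFoundedLT.induction with
    | ind α ih =>
      rw [hf α]
      refine hg _ ((hseg α).image f) ?_
      rintro _ ⟨β, hβ, rfl⟩
      exact (ih β hβ).1
  exact ⟨f, fun α => (hP α).1, fun α β hαβ => (hP β).2 _ (mem_image_of_mem f hαβ)⟩

theorem exists_uncountable_fiber_s14 {Y ι : Type*} [Countable ι] {A : Set Y} (hA : ¬ A.Countable)
    (τ : Y → ι) : ∃ t, ¬ {y ∈ A | τ y = t}.Countable := by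
  by_contra! hcon
  exact hA ((countable_iUnion hcon).mono fun y hy => mem_iUnion.2 (⟨τ y, hy, rfl⟩ : ∃ t, y ∈ {y ∈ A | τ y = t}))

theorem not_countable_of_unbounded {I : Type*} [LinearOrder I]
    (hbdd : ∀ s : Set I, s.Countable → ∃ β, ∀ α ∈ s, α < β) {A : Set I}
    (hA : ∀ α, ∃ β ∈ A, α ≤ β) : ¬ A.Countable := by
  intro h
  obtain ⟨β, hβ⟩ := hbdd A h
  obtain ⟨γ, hγ, hle⟩ := hA β
  exact absurd (hβ γ hγ) hle.not_gt

/-- Martin's Axiom for posets ordered by information: larger conditions are stronger. -/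
theorem MartinsAxiom.exists_directed (hMA : MartinsAxiom) {P ι : Type} [PartialOrder P] [Nonempty P]
    (hccc : ∀ A : Set P, ¬ A.Countable → ∃ p ∈ A, ∃ q ∈ A, p ≠ q ∧ ∃ r, p ≤ r ∧ q ≤ r)
    (hι : Cardinal.mk ι < Cardinal.continuum) (D : ι → Set P) (hD : ∀ i p, ∃ q ∈ D i, p ≤ q) :
    ∃ G : Set P, (∀ p ∈ G, ∀ q ∈ G, ∃ r ∈ G, p ≤ r ∧ q ≤ r) ∧ ∀ i, (G ∩ D i).Nonempty := by
  obtain ⟨G, -, -, hdir, hG⟩ := hMA Pᵒᵈ inferInstance ‹Nonempty P› (by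
      intro A hA
      by_contra hcount
      obtain ⟨p, hp, q, hq, hne, r, hpr, hqr⟩ := hccc A hcount
      exact hA p hp q hq hne ⟨r, hpr, hqr⟩)
    (range D) (Cardinal.mk_range_le.trans_lt hι) (by
      rintro _ ⟨i, rfl⟩ p
      exact hD i p)
  exact ⟨G, hdir, fun i => hG _ ⟨i, rfl⟩⟩

/-- A pair of finite sets approximating a set `a ⊆ ℕ` and an `R`-free set of indices `α` for which
the traces `a ∩ p α` look like branches of a tree. -/
def IsTreeCondition {I : Type*} (p : I → Set ℕ) (R : I → I → Prop) (q : Finset ℕ × Finset I) :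
    Prop :=
  (q.2 : Set I).Pairwise R ∧
    ∀ k ∈ q.1, ∀ α ∈ q.2, ∀ β ∈ q.2, k ∈ p α → k ∈ p β → ∀ i ≤ k, i ∈ p α ↔ i ∈ p β

theorem IsTreeCondition.exists_compatible {I : Type*} [DecidableEq I] {p : I → Set ℕ}
    {R : I → I → Prop}
    (hR : ∀ 𝓕 : Set (Finset I), ¬ 𝓕.Countable → (∀ F ∈ 𝓕, (F : Set I).Pairwise R) →
      ∃ F ∈ 𝓕, ∃ F' ∈ 𝓕, F ≠ F' ∧ ((F ∪ F' : Finset I) : Set I).Pairwise R)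
    {A : Set (Finset ℕ × Finset I)} (hA : ¬ A.Countable) (hq : ∀ q ∈ A, IsTreeCondition p R q) :
    ∃ q ∈ A, ∃ q' ∈ A, q ≠ q' ∧ IsTreeCondition p R (q ⊔ q') := by
  classical
  obtain ⟨⟨s, T⟩, hsT⟩ := exists_uncountable_fiber_s14 hA (fun q => (q.1,
    q.2.image fun α => (Finset.range (q.1.sup id + 1)).filter (· ∈ p α)))
  obtain ⟨_, ⟨⟨s₁, F⟩, hF, rfl⟩, _, ⟨⟨s₂, F'⟩, hF', rfl⟩, hne, hpair⟩ :=
    hR (Prod.snd '' _) (fun hc => hsT (countable_of_injective_of_countable_image (by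
      rintro ⟨s₁, F₁⟩ h₁ ⟨s₂, F₂⟩ h₂ (rfl : F₁ = F₂)
      have e₁ := (Prod.mk.inj h₁.2).1
      have e₂ := (Prod.mk.inj h₂.2).1
      exact Prod.ext (e₁.trans e₂.symm) rfl) hc)) (by
      rintro _ ⟨q, hqA, rfl⟩
      exact (hq q hqA.1).1)
  obtain ⟨rfl, e₁⟩ := Prod.mk.inj hF.2
  obtain ⟨h₂, e₂⟩ := Prod.mk.inj hF'.2
  dsimp only at h₂ e₁ e₂ hne hpair
  subst h₂
  have hcross : ∀ {F₁ F₂ : Finset I}, (s₂, F₁) ∈ A →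
      F₁.image (fun α => (Finset.range (s₂.sup id + 1)).filter (· ∈ p α)) = T →
      F₂.image (fun α => (Finset.range (s₂.sup id + 1)).filter (· ∈ p α)) = T →
      ∀ k ∈ s₂, ∀ α ∈ F₁, ∀ β ∈ F₂, k ∈ p α → k ∈ p β → ∀ i ≤ k, i ∈ p α ↔ i ∈ p β := by
    intro F₁ F₂ hA₁ h₁ h₂ k hk α hα β hβ hkα hkβ i hi
    have hmem : (Finset.range (s₂.sup id + 1)).filter (· ∈ p β) ∈
        F₁.image (fun α => (Finset.range (s₂.sup id + 1)).filter (· ∈ p α)) := by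
      rw [h₁, ← h₂]
      exact Finset.mem_image_of_mem _ hβ
    obtain ⟨γ, hγ, hγβ⟩ := Finset.mem_image.1 hmem
    have hks : k ≤ s₂.sup id := Finset.le_sup (f := id) hk
    have htr : ∀ i ≤ k, i ∈ p γ ↔ i ∈ p β := by
      intro i hi
      have := Finset.ext_iff.1 hγβ i
      simp only [Finset.mem_filter, Finset.mem_range] at this
      have hlt : i < s₂.sup id + 1 := by omega
      tauto
    exact ((hq _ hA₁).2 k hk α hα γ hγ hkα ((htr k le_rfl).2 hkβ) i hi).trans (htr i hi)
  refine ⟨_, hF.1, _, hF'.1, fun h => hne (Prod.mk.inj h).2, hpair, ?_⟩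
  intro k hk α hα β hβ
  have hk : k ∈ s₂ := by simpa using hk
  have hα : α ∈ F ∨ α ∈ F' := Finset.mem_union.1 hα
  have hβ : β ∈ F ∨ β ∈ F' := Finset.mem_union.1 hβ
  rcases hα with hα | hα <;> rcases hβ with hβ | hβ
  · exact hcross hF.1 e₁ e₁ k hk α hα β hβ
  · exact hcross hF.1 e₁ e₂ k hk α hα β hβ
  · exact hcross hF'.1 e₂ e₁ k hk α hα β hβ
  · exact hcross hF'.1 e₂ e₂ k hk α hα β hβ

/-- Some condition forces the generic set of indices to be unbounded. -/
theorem IsTreeCondition.exists_forall_exists_lt {I : Type*} [LinearOrder I] [WellFoundedLT I]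
    (hseg : ∀ α : I, (Iio α).Countable)
    (hbdd : ∀ s : Set I, s.Countable → ∃ β, ∀ α ∈ s, α < β)
    {p : I → Set ℕ} {R : I → I → Prop}
    (hR : ∀ 𝓕 : Set (Finset I), ¬ 𝓕.Countable → (∀ F ∈ 𝓕, (F : Set I).Pairwise R) →
      ∃ F ∈ 𝓕, ∃ F' ∈ 𝓕, F ≠ F' ∧ ((F ∪ F' : Finset I) : Set I).Pairwise R) :
    ∃ q₀, IsTreeCondition p R q₀ ∧ ∀ q, IsTreeCondition p R q → q₀ ≤ q → ∀ α,
      ∃ q', IsTreeCondition p R q' ∧ q ≤ q' ∧ ∃ β ∈ q'.2, α < β := by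
  by_contra! hcon
  have hbad : ∀ α : I, ∃ q, IsTreeCondition p R q ∧ α ∈ q.2 ∧
      ∃ γ, ∀ q', IsTreeCondition p R q' → q ≤ q' → ∀ β ∈ q'.2, β ≤ γ := by
    intro α
    obtain ⟨q, hq, hle, γ, hγ⟩ := hcon (∅, {α}) ⟨by simp, by simp⟩
    exact ⟨q, hq, hle.2 (Finset.mem_singleton_self α), γ, hγ⟩
  choose q hq hαq γ hγ using hbad
  obtain ⟨f, -, hf⟩ := exists_transfinite_sequence (Y := I) (P := fun _ => True)
    (r := fun α β => γ α < β) hseg (by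
      intro s hs _
      obtain ⟨β, hβ⟩ := hbdd (γ '' s) (hs.image γ)
      exact ⟨β, trivial, fun z hz => hβ _ (mem_image_of_mem γ hz)⟩)
  have hinc : ∀ α β, α < β → ¬ IsTreeCondition p R (q (f α) ⊔ q (f β)) := by
    intro α β hαβ h
    refine absurd (hγ (f α) _ h le_sup_left (f β) ?_) (hf α β hαβ).not_ge
    exact (le_sup_right : q (f β) ≤ q (f α) ⊔ q (f β)).2 (hαq (f β))
  have hinc' : ∀ α β, α ≠ β → ¬ IsTreeCondition p R (q (f α) ⊔ q (f β)) := by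
    intro α β hne
    rcases lt_or_gt_of_ne hne with h | h
    · exact hinc α β h
    · rw [sup_comm]
      exact hinc β α h
  have hinj : (fun α => q (f α)).Injective := by
    intro α β h
    by_contra hne
    refine hinc' α β hne ?_
    dsimp only at h
    rw [h, sup_idem]
    exact hq _
  have hunc : ¬ (range fun α => q (f α)).Countable := by
    intro h
    rw [← image_univ] at h
    obtain ⟨β, hβ⟩ := hbdd univ (countable_of_injective_of_countable_image hinj.injOn h)
    exact lt_irrefl _ (hβ β trivial)
  obtain ⟨_, ⟨α, rfl⟩, _, ⟨β, rfl⟩, hne, h⟩ := IsTreeCondition.exists_compatible hR hunc (by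
    rintro _ ⟨α, rfl⟩
    exact hq _)
  exact hinc' α β (fun h => hne (by rw [h])) h

theorem MartinsAxiom.exists_treeLike (hMA : MartinsAxiom) {I : Type} [LinearOrder I]
    [WellFoundedLT I] (hI : Cardinal.mk I < Cardinal.continuum)
    (hseg : ∀ α : I, (Iio α).Countable) (hbdd : ∀ s : Set I, s.Countable → ∃ β, ∀ α ∈ s, α < β)
    {p : I → Set ℕ} {R : I → I → Prop}
    (hp : ∀ (F : Finset I) (α : I), (F : Set I).Pairwise R → α ∈ F →
      {k ∈ p α | ∀ β ∈ F, β ≠ α → k ∉ p β}.Infinite)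
    (hR : ∀ 𝓕 : Set (Finset I), ¬ 𝓕.Countable → (∀ F ∈ 𝓕, (F : Set I).Pairwise R) →
      ∃ F ∈ 𝓕, ∃ F' ∈ 𝓕, F ≠ F' ∧ ((F ∪ F' : Finset I) : Set I).Pairwise R) :
    ∃ (J : Set I) (a : Set ℕ), ¬ J.Countable ∧ J.InjOn p ∧ (∀ α ∈ J, {k ∈ a | k ∈ p α}.Infinite) ∧
      ∀ α ∈ J, ∀ β ∈ J, ∀ k ∈ a, k ∈ p α → k ∈ p β → ∀ i ≤ k, i ∈ p α ↔ i ∈ p β := by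
  classical
  obtain ⟨q₀, hq₀, hext⟩ := IsTreeCondition.exists_forall_exists_lt (p := p) hseg hbdd hR
  let P := {q : Finset ℕ × Finset I // IsTreeCondition p R q ∧ q₀ ≤ q}
  have : Nonempty P := ⟨⟨q₀, hq₀, le_rfl⟩⟩
  obtain ⟨G, hdir, hG⟩ := hMA.exists_directed (P := P) (ι := I ⊕ I × ℕ) (by
      intro A hA
      obtain ⟨_, ⟨q, hq, rfl⟩, _, ⟨q', hq', rfl⟩, hne, h⟩ :=
        IsTreeCondition.exists_compatible (A := Subtype.val '' A) hR
          (fun h => hA (countable_of_injective_of_countable_image Subtype.val_injective.injOn h))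
          (by rintro _ ⟨q, -, rfl⟩; exact q.2.1)
      exact ⟨q, hq, q', hq', fun h => hne (by rw [h]),
        ⟨q.1 ⊔ q'.1, h, q.2.2.trans le_sup_left⟩, le_sup_left (a := q.1), le_sup_right (b := q'.1)⟩)
    (by
      rw [Cardinal.mk_sum, Cardinal.mk_prod]
      simp only [Cardinal.lift_id, Cardinal.mk_nat]
      exact Cardinal.add_lt_of_lt Cardinal.aleph0_le_continuum hI
        (Cardinal.mul_lt_of_lt Cardinal.aleph0_le_continuum hI Cardinal.aleph0_lt_continuum))
    (Sum.elim (fun α => {q : P | ∃ β ∈ q.1.2, α < β})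
      (fun c => {q : P | (c.1 ∈ q.1.2 ∧ ∃ k ∈ q.1.1, k ∈ p c.1 ∧ c.2 ≤ k) ∨
        ∀ q' : P, q ≤ q' → c.1 ∉ q'.1.2})) (by
      rintro (α | ⟨α, m⟩) ⟨q, hq, hq0⟩
      · obtain ⟨q', hq', hle, h⟩ := hext q hq hq0 α
        exact ⟨⟨q', hq', hq0.trans hle⟩, h, hle⟩
      · by_cases h : ∀ q' : P, (⟨q, hq, hq0⟩ : P) ≤ q' → α ∉ q'.1.2
        · exact ⟨⟨q, hq, hq0⟩, .inr h, le_rfl⟩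
        push Not at h
        obtain ⟨⟨⟨s, F⟩, hq', hq0'⟩, hle, hα⟩ := h
        obtain ⟨k, hk, hmk⟩ := (hp F α hq'.1 hα).exists_gt m
        have hle' : (s, F) ≤ (insert k s, F) := ⟨Finset.subset_insert k s, le_rfl⟩
        refine ⟨⟨(insert k s, F), ⟨hq'.1, ?_⟩, hq0'.trans hle'⟩,
          .inl ⟨hα, k, Finset.mem_insert_self k s, hk.1, hmk.le⟩, hle.trans hle'⟩
        intro j hj β hβ γ hγ hjβ hjγ
        rcases Finset.mem_insert.1 hj with rfl | hj
        · have hβα : β = α := by_contra fun hne => hk.2 β hβ hne hjβ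
          have hγα : γ = α := by_contra fun hne => hk.2 γ hγ hne hjγ
          simp [hβα, hγα]
        · exact hq'.2 j hj β hβ γ hγ hjβ hjγ)
  refine ⟨{α | ∃ q ∈ G, α ∈ q.1.2}, {k | ∃ q ∈ G, k ∈ q.1.1}, ?_, ?_, ?_, ?_⟩
  · refine not_countable_of_unbounded hbdd fun α => ?_
    obtain ⟨q, hq, β, hβ, hαβ⟩ := hG (.inl α)
    exact ⟨β, ⟨q, hq, hβ⟩, hαβ.le⟩
  · rintro α ⟨q, hq, hα⟩ β ⟨q', hq', hβ⟩ heq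
    by_contra hne
    obtain ⟨r, -, hqr, hqr'⟩ := hdir q hq q' hq'
    obtain ⟨k, hk, hk'⟩ := (hp r.1.2 α r.2.1.1 (hqr.2 hα)).nonempty
    exact hk' β (hqr'.2 hβ) (Ne.symm hne) (heq ▸ hk)
  · rintro α ⟨q, hq, hα⟩
    refine infinite_of_forall_exists_gt fun m => ?_
    obtain ⟨q', hq', h⟩ := hG (.inr (α, m + 1))
    rcases h with ⟨-, k, hk, hkα, hmk⟩ | h
    · exact ⟨k, ⟨⟨q', hq', hk⟩, hkα⟩, hmk⟩
    · obtain ⟨r, -, hqr, hqr'⟩ := hdir q hq q' hq'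
      exact absurd (hqr.2 hα) (h r hqr')
  · rintro α ⟨q, hq, hα⟩ β ⟨q', hq', hβ⟩ k ⟨q'', hq'', hk⟩
    obtain ⟨r, hr, hqr, hqr'⟩ := hdir q hq q' hq'
    obtain ⟨t, -, hrt, hqt⟩ := hdir r hr q'' hq''
    exact t.2.1.2 k (hqt.1 hk) α (hrt.2 (hqr.2 hα)) β (hrt.2 (hqr'.2 hβ))

theorem exists_forall_notMem_of_countablyTight {I X ι : Type*} [LinearOrder I] [TopologicalSpace X]
    [CompactSpace X] [T2Space X] [Finite ι]
    (hbdd : ∀ s : Set I, s.Countable → ∃ β, ∀ α ∈ s, α < β) {K : Set X} (hK : IsClosed K) {z : X}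
    (hloc : ∀ y ∈ K, y ≠ z → ∃ V, IsOpen V ∧ V.Countable ∧ y ∈ V)
    (htight : ∀ E ⊆ K \ {z}, ¬ E.Countable → ∃ C ⊆ E, C.Countable ∧ z ∈ closure C)
    {g : I → ι → X} (hg : ∀ i, (fun ξ => g ξ i).Injective) (hgK : ∀ ξ i, g ξ i ∈ K)
    {W : I → Set X} (hW : ∀ η, IsClosed (W η)) (hzW : ∀ η, z ∉ W η) :
    ∃ ξ η, ξ < η ∧ ∀ i, g ξ i ∉ W η := by
  classical
  have := Fintype.ofFinite ι
  have hsucc : ∀ α : I, ∃ β, α < β := fun α => by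
    simpa using hbdd {α} (countable_singleton α)
  have key : ∀ (c : Finset ι) (η₀ : I), ∃ η₁, ∃ h ∈ closure (g '' Ioo η₀ η₁), ∀ i ∈ c, h i = z := by
    intro c
    induction c using Finset.induction_on with
    | empty =>
      intro η₀
      obtain ⟨ξ, hξ⟩ := hsucc η₀
      obtain ⟨η₁, hη₁⟩ := hsucc ξ
      exact ⟨η₁, g ξ, subset_closure (mem_image_of_mem g ⟨hξ, hη₁⟩), by simp⟩
    | insert i c hic ih =>
      intro η₀
      choose b h hh hhz using ih
      by_cases hcase : ∃ η ≥ η₀, h η i = z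
      · obtain ⟨η, hη, hi⟩ := hcase
        refine ⟨b η, h η, closure_mono (image_mono (Ioo_subset_Ioo_left hη)) (hh η), ?_⟩
        simpa [hi] using hhz η
      push Not at hcase
      have hcoord : ∀ η, h η i ∈ K := by
        intro η
        refine closure_minimal (t := {f : ι → X | f i ∈ K}) ?_
          (hK.preimage (continuous_apply i)) (hh η)
        rintro _ ⟨ξ, -, rfl⟩
        exact hgK ξ i
      have hEK : (fun η => h η i) '' Ici η₀ ⊆ K \ {z} := by
        rintro _ ⟨η, hη, rfl⟩
        exact ⟨hcoord η, hcase η hη⟩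
      have hE : ¬ ((fun η => h η i) '' Ici η₀).Countable := by
        intro hE
        choose! V hVo hVc hyV using hloc
        have hO : IsOpen (⋃ y ∈ (fun η => h η i) '' Ici η₀, V y) :=
          isOpen_biUnion fun y hy => hVo y (hEK hy).1 (hEK hy).2
        have hOc : (⋃ y ∈ (fun η => h η i) '' Ici η₀, V y).Countable :=
          hE.biUnion fun y hy => hVc y (hEK hy).1 (hEK hy).2
        refine not_countable_of_unbounded hbdd (fun α => ?_)
          (hOc.preimage_of_injOn (f := fun ξ => g ξ i) (hg i).injOn)
        have hα : η₀ ≤ max η₀ α := le_max_left _ _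
        have hmem : h (max η₀ α) i ∈ ⋃ y ∈ (fun η => h η i) '' Ici η₀, V y :=
          mem_iUnion₂.2 ⟨_, mem_image_of_mem _ hα, hyV _ (hcoord _) (hcase _ hα)⟩
        obtain ⟨_, hf, ξ, hξ, rfl⟩ := mem_closure_iff.1 (hh (max η₀ α))
          ((fun f : ι → X => f i) ⁻¹' ⋃ y ∈ (fun η => h η i) '' Ici η₀, V y)
          (hO.preimage (continuous_apply i)) hmem
        exact ⟨ξ, hf, (le_max_right _ _).trans hξ.1.le⟩
      obtain ⟨C, hCE, hC, hzC⟩ := htight _ hEK hE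
      have hCE' : ∀ y ∈ C, ∃ η, η₀ ≤ η ∧ h η i = y := fun y hy => hCE hy
      have : Nonempty I := ⟨η₀⟩
      choose! m hm hmy using hCE'
      obtain ⟨β, hβ⟩ := hbdd ((b ∘ m) '' C) (hC.image _)
      have hclosed : IsClosed (closure (g '' Ioo η₀ β) ∩ {f | ∀ j ∈ c, f j = z}) := by
        have heq : {f : ι → X | ∀ j ∈ c, f j = z} = ⋂ j ∈ c, {f | f j = z} := by
          ext f
          simp
        rw [heq]
        exact isClosed_closure.inter
          (isClosed_biInter fun j _ => isClosed_eq (continuous_apply j) continuous_const)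
      have himage : IsClosed ((fun f : ι → X => f i) ''
          (closure (g '' Ioo η₀ β) ∩ {f | ∀ j ∈ c, f j = z})) :=
        (hclosed.isCompact.image (continuous_apply i)).isClosed
      have hCimage : C ⊆ (fun f : ι → X => f i) ''
          (closure (g '' Ioo η₀ β) ∩ {f | ∀ j ∈ c, f j = z}) := fun y hy =>
        ⟨h (m y), ⟨closure_mono (image_mono (Ioo_subset_Ioo (hm y hy)
          (hβ _ (mem_image_of_mem _ hy)).le)) (hh (m y)), hhz (m y)⟩, hmy y hy⟩
      obtain ⟨f, ⟨hf, hfc⟩, hfi⟩ := closure_minimal hCimage himage hzC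
      refine ⟨β, f, hf, ?_⟩
      simpa [hfi] using hfc
  obtain ⟨η₀, -⟩ := hbdd ∅ countable_empty
  obtain ⟨η₁, h, hh, hz⟩ := key Finset.univ η₀
  by_contra! hcon
  have hcl : IsClosed (⋃ i, {f : ι → X | f i ∈ W η₁}) :=
    isClosed_iUnion_of_finite fun i => (hW η₁).preimage (continuous_apply i)
  obtain ⟨i, hi⟩ := mem_iUnion.1 (closure_minimal (by
    rintro _ ⟨ξ, hξ, rfl⟩
    exact mem_iUnion.2 (hcon ξ η₁ hξ.2)) hcl hh)
  exact hzW η₁ (hz i (Finset.mem_univ i) ▸ hi)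

theorem exists_pairwise_union_of_countablyTight {I X : Type*} [LinearOrder I] [WellFoundedLT I]
    [TopologicalSpace X] [CompactSpace X] [T2Space X] (hseg : ∀ α : I, (Iio α).Countable)
    (hbdd : ∀ s : Set I, s.Countable → ∃ β, ∀ α ∈ s, α < β) {K : Set X} (hK : IsClosed K) {z : X}
    (hloc : ∀ y ∈ K, y ≠ z → ∃ V, IsOpen V ∧ V.Countable ∧ y ∈ V)
    (htight : ∀ E ⊆ K \ {z}, ¬ E.Countable → ∃ C ⊆ E, C.Countable ∧ z ∈ closure C)
    {x : I → X} {U : I → Set X} (hxK : ∀ α, x α ∈ K) (hU : ∀ α, IsClosed (U α))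
    (hUc : ∀ α, (U α).Countable) (hzU : ∀ α, z ∉ U α) (hxU : ∀ α, x α ∈ U α)
    (hlt : ∀ α β, α < β → x β ∉ U α) {𝓕 : Set (Finset I)} (h𝓕 : ¬ 𝓕.Countable)
    (hfree : ∀ F ∈ 𝓕, (F : Set I).Pairwise fun α β => x α ∉ U β) :
    ∃ F ∈ 𝓕, ∃ F' ∈ 𝓕, F ≠ F' ∧
      ((F ∪ F' : Finset I) : Set I).Pairwise fun α β => x α ∉ U β := by
  have hxinj : x.Injective := by
    intro α β h
    by_contra hne
    rcases lt_or_gt_of_ne hne with h' | h'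
    · exact hlt α β h' (h ▸ hxU α)
    · exact hlt β α h' (h ▸ hxU β)
  obtain ⟨n, hn⟩ := exists_uncountable_fiber_s14 h𝓕 Finset.card
  suffices ∀ n, ∀ 𝓖 : Set (Finset I), ¬ 𝓖.Countable →
      (∀ F ∈ 𝓖, F.card = n ∧ (F : Set I).Pairwise fun α β => x α ∉ U β) →
      ∃ F ∈ 𝓖, ∃ F' ∈ 𝓖, F ≠ F' ∧
        ((F ∪ F' : Finset I) : Set I).Pairwise fun α β => x α ∉ U β by
    obtain ⟨F, hF, F', hF', h⟩ := this n _ hn fun F hF => ⟨hF.2, hfree F hF.1⟩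
    exact ⟨F, hF.1, F', hF'.1, h⟩
  clear! 𝓕
  intro n
  induction n with
  | zero =>
    intro 𝓖 h𝓖 h
    refine absurd ((countable_singleton (∅ : Finset I)).mono fun F hF => ?_) h𝓖
    exact Finset.card_eq_zero.1 (h F hF).1
  | succ n ih =>
    intro 𝓖 h𝓖 h
    by_cases hα : ∃ α, ¬ {F ∈ 𝓖 | α ∈ F}.Countable
    · obtain ⟨α, hα⟩ := hα
      have hinj : InjOn (fun F : Finset I => F.erase α) {F ∈ 𝓖 | α ∈ F} := by
        intro F hF F' hF' heq
        rw [← Finset.insert_erase hF.2, ← Finset.insert_erase hF'.2]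
        exact congrArg _ heq
      obtain ⟨_, ⟨F, hF, rfl⟩, _, ⟨F', hF', rfl⟩, hne, hpair⟩ := ih _
        (fun hc => hα (countable_of_injective_of_countable_image hinj hc)) (by
          rintro _ ⟨F, hF, rfl⟩
          refine ⟨by rw [Finset.card_erase_of_mem hF.2, (h F hF.1).1]; rfl,
            (h F hF.1).2.mono ?_⟩
          exact_mod_cast Finset.erase_subset α F)
      refine ⟨F, hF.1, F', hF'.1, fun h => hne (by rw [h]), ?_⟩
      have h1 := (h F hF.1).2
      have h2 := (h F' hF'.1).2
      intro β hβ γ hγ hβγ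
      have hβ : β ∈ F ∨ β ∈ F' := by simpa using hβ
      have hγ : γ ∈ F ∨ γ ∈ F' := by simpa using hγ
      by_cases hβα : β = α
      · subst hβα
        rcases hγ with hγ | hγ
        · exact h1 hF.2 hγ hβγ
        · exact h2 hF'.2 hγ hβγ
      by_cases hγα : γ = α
      · subst hγα
        rcases hβ with hβ | hβ
        · exact h1 hβ hF.2 hβγ
        · exact h2 hβ hF'.2 hβγ
      exact hpair (by simp [hβα, hβ]) (by simp [hγα, hγ]) hβγ
    push Not at hα
    obtain ⟨f, hf, hf'⟩ := exists_transfinite_sequence (I := I) (P := (· ∈ 𝓖))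
      (r := fun F F' => ∀ β ∈ F, ∀ α ∈ F', x α ∉ U β) hseg (by
        intro s hs _
        have hbad : (⋃ α ∈ ⋃ F ∈ s, ⋃ β ∈ F, x ⁻¹' U β, {F ∈ 𝓖 | α ∈ F}).Countable :=
          (hs.biUnion fun F _ => F.countable_toSet.biUnion fun β _ =>
            (hUc β).preimage_of_injOn hxinj.injOn).biUnion fun α _ => hα α
        obtain ⟨F, hF, hF'⟩ := not_subset.1 fun hsub => h𝓖 (hbad.mono hsub)
        refine ⟨F, hF, fun F₀ hF₀ β hβ α hα hxα => hF' ?_⟩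
        exact mem_iUnion₂.2 ⟨α, mem_iUnion₂.2 ⟨F₀, hF₀, mem_iUnion₂.2 ⟨β, hβ, hxα⟩⟩, hF, hα⟩)
    obtain ⟨ξ, η, hξη, hnot⟩ := exists_forall_notMem_of_countablyTight (ι := Fin (n + 1))
      hbdd hK hloc htight (g := fun ξ i => x ((f ξ).orderEmbOfFin (h _ (hf ξ)).1 i))
      (W := fun η => ⋃ β ∈ f η, U β) (by
        intro i ξ η heq
        by_contra hne
        dsimp only at heq
        have hmem := fun ξ => (f ξ).orderEmbOfFin_mem (h _ (hf ξ)).1 i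
        rcases lt_or_gt_of_ne hne with h' | h'
        · exact hf' ξ η h' _ (hmem ξ) _ (hmem η) (by rw [← heq]; exact hxU _)
        · exact hf' η ξ h' _ (hmem η) _ (hmem ξ) (by rw [heq]; exact hxU _))
      (fun ξ i => hxK _) (fun η => isClosed_biUnion_finset fun β _ => hU β)
      (fun η hz => by
        obtain ⟨β, -, hβ⟩ := mem_iUnion₂.1 hz
        exact hzU β hβ)
    have hnot' : ∀ α ∈ f ξ, ∀ β ∈ f η, x α ∉ U β := by
      intro α hα β hβ hαβ
      obtain ⟨i, rfl⟩ : α ∈ range ((f ξ).orderEmbOfFin (h _ (hf ξ)).1) := by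
        rw [Finset.range_orderEmbOfFin]
        exact hα
      exact hnot i (mem_iUnion₂.2 ⟨β, hβ, hαβ⟩)
    refine ⟨f ξ, hf ξ, f η, hf η, ?_, ?_⟩
    · intro heq
      obtain ⟨α, hα⟩ : (f ξ).Nonempty := by
        rw [← Finset.card_pos, (h _ (hf ξ)).1]
        omega
      exact hnot' α hα α (heq ▸ hα) (hxU α)
    · intro β hβ γ hγ hβγ
      have hβ : β ∈ f ξ ∨ β ∈ f η := by simpa using hβ
      have hγ : γ ∈ f ξ ∨ γ ∈ f η := by simpa using hγ
      rcases hβ with hβ | hβ <;> rcases hγ with hγ | hγ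
      · exact (h _ (hf ξ)).2 hβ hγ hβγ
      · exact hnot' β hβ γ hγ
      · exact hf' ξ η hξη γ hγ β hβ
      · exact (h _ (hf η)).2 hβ hγ hβγ

theorem IsScatteredSpace.totallyDisconnectedSpace {X : Type*} [TopologicalSpace X] [T1Space X]
    (h : IsScatteredSpace X) : TotallyDisconnectedSpace X := by
  refine ⟨fun s _ hs => ?_⟩
  by_contra hsub
  obtain ⟨a, ha, U, hU, hUs⟩ := h s (Set.not_subsingleton_iff.1 hsub).nonempty
  obtain ⟨b, hb, hba⟩ := (Set.not_subsingleton_iff.1 hsub).exists_ne a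
  have haU : a ∈ U := (hUs.ge rfl).1
  obtain ⟨c, hcs, hcU, hca⟩ := hs U {a}ᶜ hU isOpen_compl_singleton (fun c _ => by
    by_cases hca : c = a
    · exact .inl (hca ▸ haU)
    · exact .inr hca) ⟨a, ha, haU⟩ ⟨b, hb, hba⟩
  exact hca (hUs.le ⟨hcU, hcs⟩)

/-- An uncountable scattered compact space contains an uncountable clopen set which is locally
countable except at one point. -/
theorem IsScatteredSpace.exists_isClopen_locallyCountable {X : Type*} [TopologicalSpace X]
    [CompactSpace X] [T2Space X] [Uncountable X] (h : IsScatteredSpace X) :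
    ∃ (K : Set X) (z : X), IsClopen K ∧ ¬ (K \ {z}).Countable ∧ z ∈ K ∧
      ∀ y ∈ K, y ≠ z → ∃ V, IsOpen V ∧ V.Countable ∧ y ∈ V := by
  have := h.totallyDisconnectedSpace
  obtain ⟨z, hz, O, hO, hOz⟩ := h {y | ¬ ∃ V, IsOpen V ∧ V.Countable ∧ y ∈ V} (by
    by_contra hempty
    have hall : ∀ y : X, ∃ V, IsOpen V ∧ V.Countable ∧ y ∈ V := by
      intro y
      by_contra hy
      exact hempty ⟨y, hy⟩
    choose V hV hVc hyV using hall
    obtain ⟨t, ht⟩ := isCompact_univ.elim_finite_subcover V hV fun y _ =>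
      mem_iUnion.2 ⟨y, hyV y⟩
    exact not_countable_univ ((t.countable_toSet.biUnion fun y _ => hVc y).mono ht))
  obtain ⟨K, hK, hzK, hKO⟩ := compact_exists_isClopen_in_isOpen hO (hOz.ge rfl).1
  refine ⟨K, z, hK, fun hc => hz ⟨K, hK.isOpen, ?_, hzK⟩, hzK, fun y hy hyz => ?_⟩
  · exact (hc.insert z).mono fun y hy => by by_cases hyz : y = z <;> simp [hyz, hy]
  · by_contra hcon
    exact hyz (hOz.le ⟨hKO hy, hcon⟩)

theorem IsScatteredSpace.exists_free_family {I X : Type*} [LinearOrder I] [WellFoundedLT I]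
    [TopologicalSpace X] [CompactSpace X] [T2Space X] [Uncountable X] (h : IsScatteredSpace X)
    (hseg : ∀ α : I, (Iio α).Countable) (hbdd : ∀ s : Set I, s.Countable → ∃ β, ∀ α ∈ s, α < β)
    {D : Set X} (hD : D.Countable) :
    ∃ (x : I → X) (U : I → Set X), (∀ α, x α ∉ D) ∧ (∀ α, IsClopen (U α)) ∧ (∀ α, x α ∈ U α) ∧
      ∀ 𝓕 : Set (Finset I), ¬ 𝓕.Countable →
        (∀ F ∈ 𝓕, (F : Set I).Pairwise fun α β => x α ∉ U β) →
        ∃ F ∈ 𝓕, ∃ F' ∈ 𝓕, F ≠ F' ∧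
          ((F ∪ F' : Finset I) : Set I).Pairwise fun α β => x α ∉ U β := by
  have := h.totallyDisconnectedSpace
  obtain ⟨K, z, hK, hKc, hzK, hloc⟩ := h.exists_isClopen_locallyCountable
  have hnhds : ∀ y ∈ K \ {z}, ∀ O, IsOpen O → y ∈ O →
      ∃ V ⊆ O, IsClopen V ∧ V.Countable ∧ z ∉ V ∧ y ∈ V := by
    intro y hy O hO hyO
    obtain ⟨V, hV, hVc, hyV⟩ := hloc y hy.1 hy.2
    obtain ⟨W, hW, hyW, hWV⟩ := compact_exists_isClopen_in_isOpen
      ((hV.inter hO).inter (isOpen_compl_singleton (x := z))) ⟨⟨hyV, hyO⟩, hy.2⟩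
    exact ⟨W, fun w hw => (hWV hw).1.2, hW, hVc.mono fun w hw => (hWV hw).1.1,
      fun hz => (hWV hz).2 rfl, hyW⟩
  by_cases htight : ∀ E ⊆ K \ {z}, ¬ E.Countable → ∃ C ⊆ E, C.Countable ∧ z ∈ closure C
  · obtain ⟨f, hf, hf'⟩ := exists_transfinite_sequence (I := I) (Y := X × Set X)
      (P := fun y => y.1 ∈ K \ {z} ∧ y.1 ∉ D ∧ IsClopen y.2 ∧ y.2.Countable ∧ z ∉ y.2 ∧ y.1 ∈ y.2)
      (r := fun y y' => y'.1 ∉ y.2) hseg (by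
        intro s hs hsP
        obtain ⟨x, hx, hx'⟩ := not_subset.1 fun hsub => hKc
          ((hD.union (hs.biUnion fun y hy => (hsP y hy).2.2.2.1)).mono hsub)
        obtain ⟨V, -, hV, hVc, hzV, hxV⟩ := hnhds x hx univ isOpen_univ trivial
        exact ⟨(x, V), ⟨hx, fun h => hx' (.inl h), hV, hVc, hzV, hxV⟩, fun y hy hxy =>
          hx' (.inr (mem_iUnion₂.2 ⟨y, hy, hxy⟩))⟩)
    refine ⟨fun α => (f α).1, fun α => (f α).2, fun α => (hf α).2.1, fun α => (hf α).2.2.1,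
      fun α => (hf α).2.2.2.2.2, fun 𝓕 h𝓕 hfree => ?_⟩
    exact exists_pairwise_union_of_countablyTight hseg hbdd hK.isClosed hloc htight
      (fun α => (hf α).1.1) (fun α => (hf α).2.2.1.isClosed) (fun α => (hf α).2.2.2.1)
      (fun α => (hf α).2.2.2.2.1) (fun α => (hf α).2.2.2.2.2) hf' h𝓕 hfree
  · push Not at htight
    obtain ⟨E, hEK, hE, hEz⟩ := htight
    have hclos : ∀ C ⊆ E, C.Countable → (closure C).Countable := by
      intro C hCE hC
      have hCK : closure C ⊆ K := closure_minimal (fun y hy => (hEK (hCE hy)).1) hK.isClosed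
      choose! V _ hV hVc _ hyV using hnhds
      obtain ⟨t, ht, hsub⟩ := isClosed_closure.isCompact.elim_nhds_subcover (fun y => V y univ)
        fun y hy => by
          have hy' : y ∈ K \ {z} := ⟨hCK hy, fun h => hEz C hCE hC (h ▸ hy)⟩
          exact (hV y hy' univ isOpen_univ trivial).isOpen.mem_nhds
            (hyV y hy' univ isOpen_univ trivial)
      refine (t.countable_toSet.biUnion fun y hy => ?_).mono hsub
      exact hVc y ⟨hCK (ht y hy), fun h => hEz C hCE hC (h ▸ ht y hy)⟩ univ isOpen_univ trivial
    obtain ⟨f, hf, hf'⟩ := exists_transfinite_sequence (I := I) (Y := X × Set X)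
      (P := fun y => y.1 ∈ E ∧ y.1 ∉ D ∧ IsClopen y.2 ∧ y.2.Countable ∧ y.1 ∈ y.2)
      (r := fun y y' => y'.1 ∉ y.2 ∧ y.1 ∉ y'.2) hseg (by
        intro s hs hsP
        have hsE : Prod.fst '' s ⊆ E := by
          rintro _ ⟨y, hy, rfl⟩
          exact (hsP y hy).1
        obtain ⟨x, hx, hx'⟩ := not_subset.1 fun hsub => hE
          (((hD.union (hclos _ hsE (hs.image _))).union
            (hs.biUnion fun y hy => (hsP y hy).2.2.2.1)).mono hsub)
        obtain ⟨V, hVs, hV, hVc, -, hxV⟩ := hnhds x (hEK hx) (closure (Prod.fst '' s))ᶜ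
          isClosed_closure.isOpen_compl fun h => hx' (.inl (.inr h))
        exact ⟨(x, V), ⟨hx, fun h => hx' (.inl (.inl h)), hV, hVc, hxV⟩, fun y hy =>
          ⟨fun hxy => hx' (.inr (mem_iUnion₂.2 ⟨y, hy, hxy⟩)), fun hyV =>
            hVs hyV (subset_closure (mem_image_of_mem _ hy))⟩⟩)
    have hfree : ∀ α β, α ≠ β → (f α).1 ∉ (f β).2 := by
      intro α β hne
      rcases lt_or_gt_of_ne hne with h | h
      · exact (hf' α β h).2
      · exact (hf' β α h).1
    refine ⟨fun α => (f α).1, fun α => (f α).2, fun α => (hf α).2.1, fun α => (hf α).2.2.1,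
      fun α => (hf α).2.2.2.2, fun 𝓕 h𝓕 _ => ?_⟩
    obtain ⟨F, hF, F', hF', hne⟩ := Set.not_subsingleton_iff.1
      fun hsub : 𝓕.Subsingleton => h𝓕 hsub.countable
    exact ⟨F, hF, F', hF', hne, fun α _ β _ h => hfree α β h⟩

theorem IsScatteredSpace.countable_of_hereditarilySupercompact (hMA : MartinsAxiom)
    (hCH : Cardinal.aleph.{0} 1 < Cardinal.continuum.{0}) {X : Type*} [TopologicalSpace X] [CompactSpace X]
    [T2Space X] [SeparableSpace X] (h : IsScatteredSpace X) (hX : IsHereditarilySupercompact X) :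
    Countable X := by
  classical
  by_contra hunc
  rw [not_countable_iff] at hunc
  obtain ⟨D, hD, hDd⟩ := exists_countable_dense X
  have hDinf : D.Infinite := by
    intro hfin
    have : D = univ := by rw [← hDd.closure_eq, hfin.isClosed.closure_eq]
    exact not_countable_univ (this ▸ hD)
  have := hDinf.to_subtype
  have := hD.to_subtype
  obtain ⟨ψ⟩ := nonempty_equiv_of_countable (α := ℕ) (β := D)
  have hd : (fun k => (ψ k : X)).Injective := Subtype.val_injective.comp ψ.injective
  obtain ⟨I, _, _, hI, hseg, hbdd⟩ := exists_wellOrder_aleph_one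
  obtain ⟨x, U, hxD, hU, hxU, hfree⟩ := h.exists_free_family hseg hbdd hD
  obtain ⟨J, a, hJ, hpJ, hinf, htree⟩ := hMA.exists_treeLike (hI.trans_lt hCH) hseg hbdd
    (p := fun α => {k | (ψ k : X) ∈ U α}) (R := fun α β => x α ∉ U β) (by
      intro F α hF hα hfin
      have hO : IsOpen ((U α \ ⋃ β ∈ F.erase α, U β) \ (fun k => (ψ k : X)) ''
          {k ∈ {k | (ψ k : X) ∈ U α} | ∀ β ∈ F, β ≠ α → k ∉ {k | (ψ k : X) ∈ U β}}) :=
        ((hU α).isOpen.sdiff (isClosed_biUnion_finset fun β _ => (hU β).isClosed)).sdiff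
          (hfin.image _).isClosed
      obtain ⟨y, hyO, hyD⟩ := hDd.inter_open_nonempty _ hO ⟨x α, ⟨hxU α, fun hx => by
        obtain ⟨β, hβ, hxβ⟩ := mem_iUnion₂.1 hx
        exact hF hα (Finset.mem_of_mem_erase hβ) (Finset.ne_of_mem_erase hβ).symm hxβ⟩, by
        rintro ⟨k, -, hk⟩
        exact hxD α (hk ▸ (ψ k).2)⟩
      obtain ⟨k, hk⟩ := ψ.surjective ⟨y, hyD⟩
      have hky : (ψ k : X) = y := congrArg Subtype.val hk
      subst hky
      exact hyO.2 ⟨k, ⟨hyO.1.1, fun β hβ hne hkβ =>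
        hyO.1.2 (mem_iUnion₂.2 ⟨β, Finset.mem_erase.2 ⟨hne, hβ⟩, hkβ⟩)⟩, rfl⟩) hfree
  set Z : Set X := closure ((fun k => (ψ k : X)) '' a) with hZ
  have hZc : IsClosed Z := isClosed_closure
  have : CompactSpace Z := isCompact_iff_compactSpace.1 hZc.isCompact
  have : Uncountable J := by rwa [← not_countable_iff]
  refine not_isSupercompact_of_treeLike (Z := Z) (κ := a) (J := J)
    (e := fun k => ⟨ψ k, subset_closure (mem_image_of_mem _ k.2)⟩)
    (V := fun α => Subtype.val ⁻¹' U α) ?_ (fun α => (hU α).preimage continuous_subtype_val)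
    ?_ ?_ ?_ (hX Z hZc)
  · rw [DenseRange, Subtype.dense_iff]
    refine fun y hy => closure_mono ?_ hy
    rintro _ ⟨k, hk, rfl⟩
    exact ⟨_, ⟨⟨k, hk⟩, rfl⟩, rfl⟩
  · intro α hfin
    refine hinf α α.2 ((hfin.image Subtype.val).subset ?_)
    rintro k ⟨hk, hkα⟩
    exact ⟨⟨k, hk⟩, hkα, rfl⟩
  · intro α β hne
    have hpne : {k | (ψ k : X) ∈ U α} ≠ {k | (ψ k : X) ∈ U β} := fun heq =>
      hne (Subtype.ext (hpJ α.2 β.2 heq))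
    obtain ⟨i, hi⟩ : ∃ i, ¬ ((ψ i : X) ∈ U α ↔ (ψ i : X) ∈ U β) := by
      by_contra! hcon
      exact hpne (Set.ext hcon)
    refine ((finite_Iio i).preimage Subtype.val_injective.injOn).subset ?_
    rintro k ⟨hkα, hkβ⟩
    by_contra hki
    exact hi (htree α α.2 β β.2 k k.2 hkα hkβ i (not_lt.1 hki))
  · intro B hB
    obtain ⟨r, hr, f, hf, hfr⟩ := exists_treeLike_sequence
      (p := fun α : J => {k | (ψ k : X) ∈ U α}) (injOn_iff_injective.1 hpJ)
      (fun α β k hk => htree α α.2 β β.2 k hk) hB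
    exact ⟨r, hr, f, hf, fun m n hmn k => hfr m n hmn k k.2⟩

theorem eq_of_le_of_compact_t2 {X : Type*} {t s : TopologicalSpace X} (hle : t ≤ s)
    (ht : @CompactSpace X t) (hs : @T2Space X s) : t = s := by
  refine le_antisymm hle fun A hA => ?_
  have hclosed : @IsClosedMap X X t s id :=
    @Continuous.isClosedMap X X t s _ hs id (continuous_id_iff_le.2 hle)
  have hA' := hclosed Aᶜ ((@isClosed_compl_iff X t A).2 hA)
  rw [image_id] at hA'
  exact (@isClosed_compl_iff X s A).1 hA'

theorem secondCountableTopology_of_countable_compact (X : Type*) [t : TopologicalSpace X]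
    [CompactSpace X] [T2Space X] [Countable X] : SecondCountableTopology X := by
  have hsep : ∀ c : X × X, ∃ U V : Set X, IsOpen U ∧ IsOpen V ∧
      (c.1 ≠ c.2 → c.1 ∈ U ∧ c.2 ∈ V ∧ Disjoint U V) := by
    rintro ⟨x, y⟩
    by_cases hxy : x = y
    · exact ⟨∅, ∅, isOpen_empty, isOpen_empty, fun h => absurd hxy h⟩
    · obtain ⟨U, V, hU, hV, h⟩ := t2_separation hxy
      exact ⟨U, V, hU, hV, fun _ => h⟩
  choose U V hU hV h using hsep
  refine ⟨⟨_, (countable_range U).union (countable_range V), ?_⟩⟩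
  refine eq_of_le_of_compact_t2 (le_generateFrom (by
    rintro _ (⟨c, rfl⟩ | ⟨c, rfl⟩)
    exacts [hU c, hV c])) inferInstance ?_
  refine @T2Space.mk X (generateFrom (range U ∪ range V)) fun x y hxy => ?_
  exact ⟨U (x, y), V (x, y), isOpen_generateFrom_of_mem (.inl ⟨_, rfl⟩),
    isOpen_generateFrom_of_mem (.inr ⟨_, rfl⟩), h (x, y) hxy⟩

theorem IsSupercompact.of_continuous_injective_real {Z : Type*} [t : TopologicalSpace Z]
    [CompactSpace Z] {f : Z → ℝ} (hf : Continuous f) (hinj : f.Injective) : IsSupercompact Z := by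
  classical
  have hind : t = induced f inferInstance := (hf.isClosedEmbedding hinj).isInducing.eq_induced
  refine ⟨preimage f '' {s | ∃ a, s = Ioi a ∨ s = Iio a}, ?_, ?_⟩
  · rw [hind, ← induced_generateFrom_eq]
    exact congrArg _ (OrderTopology.topology_eq_generate_intervals (α := ℝ)).symm
  intro C hC hcov
  have hmem : ∀ z, (∃ a, f ⁻¹' Ioi a ∈ C ∧ a < f z) ∨ ∃ a, f ⁻¹' Iio a ∈ C ∧ f z < a := by
    intro z
    obtain ⟨s, hs, hz⟩ := hcov.ge (mem_univ z)
    obtain ⟨_, ⟨a, rfl | rfl⟩, rfl⟩ := hC hs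
    exacts [.inl ⟨a, hs, hz⟩, .inr ⟨a, hs, hz⟩]
  rcases isEmpty_or_nonempty Z with hZ | hZ
  · exact ⟨∅, empty_subset _, finite_empty, by simp, Subsingleton.elim _ _⟩
  set L : Set Z := {z | ∃ a, f ⁻¹' Iio a ∈ C ∧ f z < a} with hL
  have hLo : IsOpen L := by
    have : L = ⋃ a ∈ {a | f ⁻¹' Iio a ∈ C}, f ⁻¹' Iio a := by
      ext z
      simp [hL]
    rw [this]
    exact isOpen_biUnion fun a _ => isOpen_Iio.preimage hf
  rcases Lᶜ.eq_empty_or_nonempty with hLe | hLn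
  · obtain ⟨z, -, hz⟩ := isCompact_univ.exists_isMaxOn univ_nonempty hf.continuousOn
    obtain ⟨a, ha, hza⟩ : z ∈ L := compl_empty_iff.1 hLe ▸ mem_univ z
    refine ⟨{f ⁻¹' Iio a}, singleton_subset_iff.2 ha, finite_singleton _, by simp, ?_⟩
    rw [sUnion_singleton, eq_univ_iff_forall]
    exact fun w => (hz (mem_univ w)).trans_lt hza
  obtain ⟨z, hz, hzmin⟩ := hLo.isClosed_compl.isCompact.exists_isMinOn hLn hf.continuousOn
  obtain ⟨b, hb, hbz⟩ := (hmem z).resolve_right hz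
  rcases {w | f w ≤ b}.eq_empty_or_nonempty with hbe | hbn
  · refine ⟨{f ⁻¹' Ioi b}, singleton_subset_iff.2 hb, finite_singleton _, by simp, ?_⟩
    rw [sUnion_singleton, eq_univ_iff_forall]
    exact fun w => show b < f w from lt_of_not_ge (eq_empty_iff_forall_notMem.1 hbe w)
  obtain ⟨w, hw, hwmax⟩ := (isClosed_le hf continuous_const).isCompact.exists_isMaxOn hbn
    hf.continuousOn
  obtain ⟨a, ha, hwa⟩ : w ∈ L := by
    by_contra hwL
    exact (hbz.trans_le (hzmin hwL)).not_ge hw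
  refine ⟨{f ⁻¹' Iio a, f ⁻¹' Ioi b}, insert_subset ha (singleton_subset_iff.2 hb),
    toFinite _, (ncard_insert_le _ _).trans (by simp), ?_⟩
  rw [sUnion_pair, eq_univ_iff_forall]
  intro y
  rcases le_or_gt (f y) b with hy | hy
  · exact .inl ((hwmax hy).trans_lt hwa)
  · exact .inr hy

theorem exists_continuous_injective_real (X : Type*) [TopologicalSpace X] [CompactSpace X]
    [T2Space X] [TotallyDisconnectedSpace X] [SecondCountableTopology X] :
    ∃ f : X → ℝ, Continuous f ∧ f.Injective := by
  classical
  have := (Clopens.countable_iff_secondCountable (X := X)).2 inferInstance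
  obtain ⟨B, hB⟩ := exists_surjective_nat (Clopens X)
  refine ⟨fun x => (cantorSetHomeomorphNatToBool.symm fun n => decide (x ∈ B n) : cantorSet),
    continuous_subtype_val.comp (cantorSetHomeomorphNatToBool.symm.continuous.comp
      (continuous_pi fun n => ?_)), fun x y hxy => ?_⟩
  · exact (continuous_bool_rng true).2 (by simpa [preimage] using (B n).isClopen)
  · have heq := cantorSetHomeomorphNatToBool.symm.injective (Subtype.val_injective hxy)
    by_contra hne
    obtain ⟨U, hU, hxU, hyU⟩ := exists_isClopen_of_totally_separated hne
    obtain ⟨n, hn⟩ := hB ⟨U, hU⟩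
    have hmem : x ∈ B n ↔ y ∈ B n := by simpa using congrFun heq n
    rw [hn] at hmem
    exact hyU (hmem.1 hxU)

theorem aleph_one_lt_continuum_zero (h : Cardinal.aleph.{u} 1 < Cardinal.continuum.{u}) :
    Cardinal.aleph.{0} 1 < Cardinal.continuum.{0} :=
  Cardinal.lift_lt.{0, u}.1 (by simpa using h)

/-- Under MA + ¬CH, a scattered compact Hausdorff space is metrizable if and only if it is
separable and hereditarily supercompact. -/
theorem scattered_metrizable_iff_separable_hereditarilySupercompact
    (hMA : MartinsAxiom) (hCH : Cardinal.aleph 1 < Cardinal.continuum)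
    (X : Type u) [TopologicalSpace X] [CompactSpace X] [T2Space X]
    (hscat : IsScatteredSpace X) :
    TopologicalSpace.MetrizableSpace X ↔
      (TopologicalSpace.SeparableSpace X ∧ IsHereditarilySupercompact X) := by
  constructor
  · intro h
    let := metrizableSpaceMetric X
    have := hscat.totallyDisconnectedSpace
    have : SecondCountableTopology X := inferInstance
    obtain ⟨f, hf, hinj⟩ := exists_continuous_injective_real X
    refine ⟨inferInstance, fun Z hZ => ?_⟩
    have : CompactSpace Z := isCompact_iff_compactSpace.1 hZ.isCompact
    exact .of_continuous_injective_real (hf.comp continuous_subtype_val)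
      (hinj.comp Subtype.val_injective)
  · rintro ⟨hsep, hsuper⟩
    have := hscat.countable_of_hereditarilySupercompact hMA
      (aleph_one_lt_continuum_zero hCH) hsuper
    have := secondCountableTopology_of_countable_compact X
    infer_instance
end
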